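/- arXiv:1904.12262 — 11 statements merged into one kernel-verified Lean document; each statement's English description precedes it below -/
import Mathlib

section
/- Let K be a convex body in ℝ^d. If the complement K^c = ℝ^d \ K admits a weak tiling by translates of K, then K is a convex polytope, i.e. K is the convex hull of a finite set of points. -/
open MeasureTheory Set Filter
open scoped RealInnerProductSpace Pointwise ENNReal

noncomputable section

/-- A convex body: a compact convex set with nonempty interior. -/
def IsConvexBody {d : ℕ} (K : Set (EuclideanSpace ℝ (Fin d))) : Prop :=
  IsCompact K ∧ Convex ℝ K ∧ (interior K).Nonempty

/-- A convex polytope: the convex hull of finitely many points. -/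
def IsConvexPolytope {d : ℕ} (K : Set (EuclideanSpace ℝ (Fin d))) : Prop :=
  ∃ S : Set (EuclideanSpace ℝ (Fin d)), S.Finite ∧ K = convexHull ℝ S

section Touching

variable {E : Type*} [NormedAddCommGroup E] [InnerProductSpace ℝ E]

/-- A closed ball inside `K` touches the boundary of `K` at `p`, with outer unit normal `n`. -/
def IsTouchingNormal (K : Set E) (p n : E) : Prop :=
  p ∉ interior K ∧ ‖n‖ = 1 ∧ ∃ r : ℝ, 0 < r ∧ Metric.closedBall (p - r • n) r ⊆ K

theorem IsTouchingNormal.mem {K : Set E} {p n : E} (h : IsTouchingNormal K p n) : p ∈ K := by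
  obtain ⟨-, hn, r, hr, hb⟩ := h
  apply hb
  simp [Metric.mem_closedBall, norm_smul, hn, abs_of_pos hr]

/-- At a touching point, the supporting direction is unique. -/
theorem IsTouchingNormal.eq_norm_smul {K : Set E} {p n v : E} (h : IsTouchingNormal K p n)
    (hv : ∀ y ∈ K, ⟪v, y⟫ ≤ ⟪v, p⟫) : v = ‖v‖ • n := by
  obtain ⟨-, hn, r, hr, hb⟩ := h
  rcases eq_or_ne v 0 with rfl | hv0
  · simp
  have hvn : 0 < ‖v‖ := norm_pos_iff.2 hv0
  have hmem : p - r • n + (r * ‖v‖⁻¹) • v ∈ K := by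
    apply hb
    simp [Metric.mem_closedBall, dist_eq_norm, norm_smul, abs_of_pos hr, hvn.ne']
  have h1 := hv _ hmem
  rw [inner_add_right, inner_sub_right, real_inner_smul_right, real_inner_smul_right,
    real_inner_self_eq_norm_sq] at h1
  have h2 : r * ‖v‖⁻¹ * ‖v‖ ^ 2 = r * ‖v‖ := by field_simp
  rw [h2] at h1
  have h3 : ‖v‖ ≤ ⟪v, n⟫ := le_of_mul_le_mul_left (by linarith) hr
  have h4 : ⟪v, n⟫ = ‖v‖ * ‖n‖ :=
    le_antisymm (real_inner_le_norm v n) (by rw [hn, mul_one]; exact h3)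
  have h5 := inner_eq_norm_mul_iff_real.1 h4
  rwa [hn, one_smul] at h5

theorem exists_isTouchingNormal [ProperSpace E] {K : Set E} (hK : IsClosed K) (hne : Kᶜ.Nonempty)
    {x : E} (hx : x ∈ interior K) :
    ∃ p n, IsTouchingNormal K p n ∧ Metric.infDist x Kᶜ = ⟪n, p⟫ - ⟪n, x⟫ := by
  obtain ⟨p, hp, hpx⟩ := isClosed_closure.exists_infDist_eq_dist hne.closure x
  rw [Metric.infDist_closure] at hpx
  rw [closure_compl] at hp
  have hr : 0 < Metric.infDist x Kᶜ := by
    rw [hpx, dist_pos]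
    rintro rfl
    exact hp hx
  set r := Metric.infDist x Kᶜ with hrdef
  have hnorm : ‖p - x‖ = r := by rw [hpx, dist_comm, dist_eq_norm]
  have hn : ‖r⁻¹ • (p - x)‖ = 1 := by
    rw [norm_smul, hnorm, norm_inv, Real.norm_of_nonneg hr.le, inv_mul_cancel₀ hr.ne']
  have hrn : r • (r⁻¹ • (p - x)) = p - x := smul_inv_smul₀ hr.ne' _
  refine ⟨p, r⁻¹ • (p - x), ⟨hp, hn, r, hr, ?_⟩, ?_⟩
  · rw [hrn, sub_sub_cancel, ← closure_ball x hr.ne']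
    exact closure_minimal Metric.ball_infDist_compl_subset hK
  · rw [← inner_sub_right, real_inner_smul_left, real_inner_self_eq_norm_sq, hnorm]
    field_simp

/-- A polyhedron has finitely many extreme points. -/
theorem finite_extremePoints_of_halfspaces {N : Set (E × ℝ)} (hN : N.Finite) :
    (extremePoints ℝ {x : E | ∀ z ∈ N, ⟪z.1, x⟫ ≤ z.2}).Finite := by
  refine Set.Finite.of_finite_image (f := fun x => {z ∈ N | ⟪z.1, x⟫ = z.2})
    (hN.finite_subsets.subset ?_) ?_
  · rintro _ ⟨x, -, rfl⟩
    exact sep_subset _ _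
  intro x hx y hy hxy
  have hact : ∀ z ∈ N, ⟪z.1, x⟫ = z.2 → ⟪z.1, y⟫ = z.2 := fun z hz h =>
    ((Set.ext_iff.1 hxy z).1 ⟨hz, h⟩).2
  have hev : ∀ᶠ ε : ℝ in nhdsWithin 0 (Ioi 0),
      ∀ z ∈ N, ⟪z.1, x + ε • (x - y)⟫ ≤ z.2 := by
    rw [Filter.eventually_all_finite hN]
    intro z hz
    rcases (hx.1 z hz).eq_or_lt with h | h
    · refine Filter.Eventually.of_forall fun ε => ?_
      rw [inner_add_right, real_inner_smul_right, inner_sub_right, h, hact z hz h]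
      simp
    · have hc : ContinuousAt (fun ε : ℝ => ⟪z.1, x + ε • (x - y)⟫) 0 := by fun_prop
      have : ∀ᶠ ε : ℝ in nhds 0, ⟪z.1, x + ε • (x - y)⟫ < z.2 :=
        hc.eventually_lt continuousAt_const (by simpa using h)
      exact (this.filter_mono nhdsWithin_le_nhds).mono fun _ h => h.le
  obtain ⟨ε, hε, hε0⟩ := (hev.and self_mem_nhdsWithin).exists
  have hε0 : 0 < ε := hε0
  refine (hx.2 hy.1 hε ⟨ε / (1 + ε), 1 / (1 + ε), by positivity, by positivity,
    by field_simp; ring, ?_⟩).symm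
  rw [smul_add, smul_smul, ← sub_eq_zero]
  match_scalars <;> field_simp <;> ring

variable [CompleteSpace E]

theorem IsTouchingNormal.inner_le {K : Set E} {p n : E}
    (h : IsTouchingNormal K p n) (hK : Convex ℝ K) (hint : (interior K).Nonempty) {y : E} (hy : y ∈ K) :
    ⟪n, y⟫ ≤ ⟪n, p⟫ := by
  obtain ⟨f, hf⟩ := geometric_hahn_banach_open_point hK.interior isOpen_interior h.1
  set v := (InnerProductSpace.toDual ℝ E).symm f
  have hfv (x : E) : ⟪v, x⟫ = f x := InnerProductSpace.toDual_symm_apply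
  have hle : ∀ y ∈ K, ⟪v, y⟫ ≤ ⟪v, p⟫ := by
    intro y hy
    rw [hfv, hfv]
    have hsub : closure (interior K) ⊆ {y | f y ≤ f p} :=
      closure_minimal (fun a ha => (hf a ha).le) (isClosed_le f.continuous continuous_const)
    exact hsub (by rw [hK.closure_interior_eq_closure_of_nonempty_interior hint]
                   exact subset_closure hy)
  have hvn := h.eq_norm_smul hle
  obtain ⟨o, ho⟩ := hint
  have hv0 : 0 < ‖v‖ := by
    rw [norm_pos_iff]
    intro h0
    have := hf o ho
    rw [← hfv, ← hfv, h0] at this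
    simp at this
  have h1 := hle y hy
  rw [hvn, real_inner_smul_left, real_inner_smul_left] at h1
  exact le_of_mul_le_mul_left h1 hv0

/-- If `K` and a non-overlapping translate of `K` meet at two touching points, then these
have the same supporting halfspace. -/
theorem IsTouchingNormal.eq_of_translate {K : Set E} (hK : Convex ℝ K)
    (hint : (interior K).Nonempty) {p q n m t : E}
    (hp : IsTouchingNormal K p n) (hq : IsTouchingNormal K q m)
    (ht : t ∉ interior K - interior K) (hpt : p - t ∈ K) (hqt : q - t ∈ K) :
    n = m ∧ ⟪n, p⟫ = ⟪m, q⟫ := by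
  have hdisj : Disjoint (interior K) ((fun x => x - t) ⁻¹' interior K) := by
    rw [Set.disjoint_left]
    intro a ha hat
    exact ht ⟨a, ha, a - t, hat, by simp⟩
  have hopen : IsOpen ((fun x => x - t) ⁻¹' interior K) :=
    isOpen_interior.preimage (by fun_prop)
  have hconv : Convex ℝ ((fun x => x - t) ⁻¹' interior K) := by
    simpa [sub_eq_add_neg] using hK.interior.translate_preimage_left (-t)
  obtain ⟨f, u, hfu, huf⟩ := geometric_hahn_banach_open hK.interior isOpen_interior hconv hdisj
  have hKcl : K ⊆ closure (interior K) := by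
    rw [hK.closure_interior_eq_closure_of_nonempty_interior hint]
    exact subset_closure
  have hle : ∀ y ∈ K, f y ≤ u := fun y hy =>
    closure_minimal (t := {y | f y ≤ u}) (fun a ha => (hfu a ha).le)
      (isClosed_le f.continuous continuous_const) (hKcl hy)
  have hge : ∀ y, y - t ∈ K → u ≤ f y := by
    intro y hy
    have := closure_minimal (t := {y | u ≤ f (y + t)}) (s := interior K)
      (fun a ha => huf (a + t) (by simpa using ha))
      (isClosed_le continuous_const (by fun_prop)) (hKcl hy)
    simpa using this
  have hfp : f p = u := le_antisymm (hle p hp.mem) (hge p hpt)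
  have hfq : f q = u := le_antisymm (hle q hq.mem) (hge q hqt)
  set v := (InnerProductSpace.toDual ℝ E).symm f
  have hfv (x : E) : ⟪v, x⟫ = f x := InnerProductSpace.toDual_symm_apply
  have hvp := hp.eq_norm_smul (v := v) (fun y hy => by rw [hfv, hfv, hfp]; exact hle y hy)
  have hvq := hq.eq_norm_smul (v := v) (fun y hy => by rw [hfv, hfv, hfq]; exact hle y hy)
  obtain ⟨o, ho⟩ := hint
  have hv0 : v ≠ 0 := by
    intro h0
    have := hfu o ho
    rw [← hfp, ← hfv, ← hfv, h0] at this
    simp at this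
  have hvn : ‖v‖ ≠ 0 := norm_ne_zero_iff.2 hv0
  have hnm : n = m := smul_right_injective E hvn (hvp.symm.trans hvq)
  refine ⟨hnm, mul_left_cancel₀ hvn ?_⟩
  rw [← real_inner_smul_left, ← real_inner_smul_left, ← hvp, ← hvq, hfv, hfv, hfp, hfq]

/-- The pairs `(n, c)` such that the halfspace `⟪n, x⟫ ≤ c` supports `K` at a touching point. -/
def touchingHalfspaces (K : Set E) : Set (E × ℝ) :=
  {z | ∃ p, IsTouchingNormal K p z.1 ∧ z.2 = ⟪z.1, p⟫}

theorem eq_iInter_touchingHalfspaces [ProperSpace E] {K : Set E} (hK : IsClosed K)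
    (hconv : Convex ℝ K) (hint : (interior K).Nonempty) (hfin : (touchingHalfspaces K).Finite) :
    K = {x | ∀ z ∈ touchingHalfspaces K, ⟪z.1, x⟫ ≤ z.2} := by
  apply Subset.antisymm
  · rintro x hx z ⟨p, hp, hz⟩
    rw [hz]
    exact hp.inner_le hconv hint hx
  intro y hy
  by_contra hyK
  obtain ⟨o, ho⟩ := hint
  obtain ⟨q, hqs, hqi, hqK⟩ : ∃ q ∈ segment ℝ o y, q ∉ interior K ∧ q ∈ K := by
    by_contra! hcon
    obtain ⟨a, -, ha, ha'⟩ := (convex_segment (𝕜 := ℝ) o y).isPreconnected (interior K) Kᶜ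
      isOpen_interior hK.isOpen_compl (fun a ha => or_iff_not_imp_left.2 (hcon a ha))
      ⟨o, left_mem_segment ℝ o y, ho⟩ ⟨y, right_mem_segment ℝ o y, hyK⟩
    exact ha' (interior_subset ha)
  have hclosed : IsClosed (⋃ z ∈ touchingHalfspaces K,
      {x : E | Metric.infDist x Kᶜ = z.2 - ⟪z.1, x⟫}) :=
    hfin.isClosed_biUnion fun z _ =>
      isClosed_eq (Metric.continuous_infDist_pt _) (by fun_prop)
  have hsub : interior K ⊆ ⋃ z ∈ touchingHalfspaces K,
      {x : E | Metric.infDist x Kᶜ = z.2 - ⟪z.1, x⟫} := by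
    intro x hx
    obtain ⟨p, n, hpn, hd⟩ := exists_isTouchingNormal hK ⟨y, hyK⟩ hx
    exact mem_biUnion (x := (n, ⟪n, p⟫)) ⟨p, hpn, rfl⟩ hd
  have hq : q ∈ closure (interior K) := by
    rw [hconv.closure_interior_eq_closure_of_nonempty_interior ⟨o, ho⟩]
    exact subset_closure hqK
  obtain ⟨z, hz, hqz⟩ := mem_iUnion₂.1 (closure_minimal hsub hclosed hq)
  have hq0 : Metric.infDist q Kᶜ = 0 := by
    rw [← Metric.mem_closure_iff_infDist_zero ⟨y, hyK⟩, closure_compl]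
    exact hqi
  have hqz' : z.2 - ⟪z.1, q⟫ = 0 := hqz.symm.trans hq0
  have hyz := hy z hz
  have hoz : ⟪z.1, o⟫ < z.2 := by
    obtain ⟨p, hp, hzp⟩ := hz
    obtain ⟨ε, hε, hb⟩ := Metric.isOpen_iff.1 isOpen_interior o ho
    have hmem : o + (ε / 2) • z.1 ∈ K := by
      apply interior_subset
      apply hb
      rw [Metric.mem_ball, dist_eq_norm, add_sub_cancel_left, norm_smul, hp.2.1,
        Real.norm_of_nonneg (by positivity)]
      linarith
    have h1 := hp.inner_le hconv ⟨o, ho⟩ hmem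
    rw [inner_add_right, real_inner_smul_right, real_inner_self_eq_norm_sq, hp.2.1] at h1
    rw [hzp]
    linarith
  obtain ⟨a, b, ha, hb, hab, rfl⟩ := hqs
  have ha0 : 0 < a := by
    refine lt_of_le_of_ne ha fun h0 => hyK ?_
    have hb1 : b = 1 := by linarith
    simpa [← h0, hb1] using hqK
  rw [inner_add_right, real_inner_smul_right, real_inner_smul_right] at hqz'
  have hz2 : z.2 = a * z.2 + b * z.2 := by rw [← add_mul, hab, one_mul]
  nlinarith [mul_lt_mul_of_pos_left hoz ha0, mul_le_mul_of_nonneg_left hyz hb]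

end Touching

theorem one_le_measure_of_notMem_interior {E : Type*} [NormedAddCommGroup E] [ProperSpace E]
    [MeasurableSpace E] [BorelSpace E] {μ : Measure E} [IsLocallyFiniteMeasure μ] {K G : Set E} (hK : IsCompact K)
    (hG : Dense G) (hμ : ∀ x ∈ G, x ∉ K → 1 ≤ μ ((fun t => x - t) ⁻¹' K))
    {p : E} (hp : p ∉ interior K) : 1 ≤ μ ((fun t => p - t) ⁻¹' K) := by
  have hcomp : IsCompact ((fun t => p - t) ⁻¹' K) :=
    (Homeomorph.subLeft p).isClosedEmbedding.isCompact_preimage hK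
  have hlim : Tendsto (fun r => μ (Metric.cthickening r ((fun t => p - t) ⁻¹' K)))
      (nhdsWithin 0 (Ioi 0)) (nhds (μ ((fun t => p - t) ⁻¹' K))) :=
    (tendsto_measure_cthickening_of_isCompact hcomp).mono_left nhdsWithin_le_nhds
  refine ge_of_tendsto hlim ?_
  filter_upwards [self_mem_nhdsWithin] with r (hr : 0 < r)
  have hpc : p ∈ closure (Kᶜ ∩ G) :=
    closure_minimal (hG.open_subset_closure_inter hK.isClosed.isOpen_compl) isClosed_closure
      (by rwa [closure_compl])
  obtain ⟨x, hx, hxp⟩ := Metric.mem_closure_iff.1 hpc r hr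
  refine (hμ x hx.2 hx.1).trans (measure_mono fun t ht => ?_)
  refine Metric.mem_cthickening_of_dist_le t (t + (p - x)) r _ ?_ ?_
  · simpa [sub_add_eq_sub_sub_swap] using ht
  · simpa [dist_eq_norm, norm_sub_rev] using hxp.le

theorem measure_interior_sub_interior_eq_zero {E : Type*} [NormedAddCommGroup E]
    [SecondCountableTopology E] [MeasurableSpace E] {μ : Measure E} {K G : Set E}
    (hG : Dense G) (hμ : ∀ x ∈ G, x ∈ K → μ ((fun t => x - t) ⁻¹' K) = 0) :
    μ (interior K - interior K) = 0 := by
  obtain ⟨D, hDG, hDc, hD⟩ := hG.exists_countable_dense_subset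
  refine measure_mono_null (t := ⋃ x ∈ D ∩ K, (fun t => x - t) ⁻¹' K) ?_
    ((measure_biUnion_null_iff (hDc.mono inter_subset_left)).2 fun x hx => hμ x (hDG hx.1) hx.2)
  rintro _ ⟨a, ha, k, hk, rfl⟩
  obtain ⟨x, hx, hxD⟩ := hD.inter_open_nonempty
    (interior K ∩ (fun x => x - (a - k)) ⁻¹' interior K)
    (isOpen_interior.inter (isOpen_interior.preimage (by fun_prop))) ⟨a, ha, by simpa using hk⟩
  have hxK : x - (a - k) ∈ K := interior_subset hx.2
  exact mem_biUnion (x := x) ⟨hxD, interior_subset hx.1⟩ hxK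

theorem finite_touchingHalfspaces {E : Type*} [NormedAddCommGroup E] [InnerProductSpace ℝ E]
    [CompleteSpace E] [MeasurableSpace E] [BorelSpace E] {μ : Measure E}
    [IsLocallyFiniteMeasure μ] {K : Set E} (hK : IsCompact K) (hconv : Convex ℝ K)
    (hint : (interior K).Nonempty) (h0 : μ (interior K - interior K) = 0)
    (h1 : ∀ p, p ∉ interior K → 1 ≤ μ ((fun t => p - t) ⁻¹' K)) :
    (touchingHalfspaces K).Finite := by
  choose p hp hpc using fun z : touchingHalfspaces K => z.2
  let A : touchingHalfspaces K → Set E := fun z =>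
    (fun t => p z - t) ⁻¹' K \ (interior K - interior K)
  have hA (z) : 1 ≤ μ (A z) := by
    rw [measure_sdiff_null h0]
    exact h1 _ (hp z).1
  have hmeas (z) : MeasurableSet (A z) :=
    ((hK.isClosed.preimage (by fun_prop)).measurableSet).diff
      isOpen_interior.sub_right.measurableSet
  have hdisj : Pairwise (Function.onFun Disjoint A) := by
    intro z w hzw
    refine Set.disjoint_left.2 fun t htz htw => hzw ?_
    obtain ⟨h1, h2⟩ := (hp z).eq_of_translate hconv hint (hp w) htz.2 htz.1 htw.1
    exact Subtype.ext (Prod.ext h1 (by rw [hpc, hpc, h2]))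
  have hsub : (⋃ z, A z) ⊆ K + -K := iUnion_subset fun z t ht =>
    ⟨p z, (hp z).mem, t - p z, by simpa using ht.1, by simp⟩
  have hfin := Measure.finite_const_le_meas_of_disjoint_iUnion μ one_pos hmeas hdisj
    ((measure_mono hsub).trans_lt (hK.add hK.neg).measure_lt_top).ne
  have huniv : {z | 1 ≤ μ (A z)} = univ := eq_univ_of_forall hA
  rw [huniv] at hfin
  exact Set.finite_coe_iff.1 (Set.finite_univ_iff.1 hfin)

/-- If the complement of a convex body `K` admits a weak tiling by translates of `K`
(there is a positive locally finite measure `μ` with `1_K ∗ μ = 1_{Kᶜ}` a.e.),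
then `K` is a convex polytope. -/
theorem polytope_of_weak_tiling_complement
    (d : ℕ) (K : Set (EuclideanSpace ℝ (Fin d)))
    (hbody : IsConvexBody K)
    (htile : ∃ μ : Measure (EuclideanSpace ℝ (Fin d)), IsLocallyFiniteMeasure μ ∧
      ∀ᵐ x ∂(volume : Measure (EuclideanSpace ℝ (Fin d))),
        (∫⁻ t, Set.indicator K (fun _ => (1 : ℝ≥0∞)) (x - t) ∂μ) =
          Set.indicator Kᶜ (fun _ => (1 : ℝ≥0∞)) x) :
    IsConvexPolytope K := by
  obtain ⟨hK, hconv, hint⟩ := hbody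
  obtain ⟨μ, hμlf, hμ⟩ := htile
  have hG := Measure.dense_of_ae hμ
  have hval (x : EuclideanSpace ℝ (Fin d)) :
      (∫⁻ t, Set.indicator K (fun _ => (1 : ℝ≥0∞)) (x - t) ∂μ) = μ ((fun t => x - t) ⁻¹' K) := by
    rw [← lintegral_indicator_one ((hK.isClosed.preimage (by fun_prop)).measurableSet)]
    rfl
  have h0 : μ (interior K - interior K) = 0 :=
    measure_interior_sub_interior_eq_zero hG fun x hx hxK => by
      rw [← hval, hx]
      simp [hxK]
  have h1 : ∀ p, p ∉ interior K → 1 ≤ μ ((fun t => p - t) ⁻¹' K) := fun p =>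
    one_le_measure_of_notMem_interior hK hG fun x hx hxK => by
      rw [← hval, hx]
      simp [hxK]
  have hfin := finite_touchingHalfspaces hK hconv hint h0 h1
  have hext : (extremePoints ℝ K).Finite := by
    rw [eq_iInter_touchingHalfspaces hK.isClosed hconv hint hfin]
    exact finite_extremePoints_of_halfspaces hfin
  refine ⟨extremePoints ℝ K, hext, ?_⟩
  rw [← (hext.isCompact_convexHull (𝕜 := ℝ)).isClosed.closure_eq,
    closure_convexHull_extremePoints hK hconv]
end
end

section
/- Let Ω ⊂ ℝ^d be a bounded measurable set of positive Lebesgue measure, and let μ be a positive locally finite Borel measure on ℝ^d such that (1_Ω ∗ μ)(x) ≤ 1 for Lebesgue-a.e. x. Then μ is translation-bounded: for every open ball B, sup_{x∈ℝ^d} μ(B + x) < ∞. -/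
open MeasureTheory Set Filter
open scoped ENNReal

noncomputable section

/-- If `Ω` lies in the ball of radius `R` about `0` and `1_Ω ∗ μ ≤ 1` a.e., then the mass of a ball of
radius `r`, scaled by the volume of `Ω`, is at most the volume of a ball of radius `r + R`. -/
theorem measure_ball_mul_volume_le_of_lintegral_indicator_le_one
    {E : Type*} [NormedAddCommGroup E] [MeasurableSpace E] [BorelSpace E]
    [SecondCountableTopology E] {ν μ : Measure E} [ν.IsAddHaarMeasure] [SFinite ν] [SFinite μ]
    {Ω : Set E} {R : ℝ} (hR : Ω ⊆ Metric.closedBall 0 R) (hmeas : MeasurableSet Ω)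
    (hle : ∀ᵐ x ∂ν, (∫⁻ t, Ω.indicator (fun _ => (1 : ℝ≥0∞)) (x - t) ∂μ) ≤ 1)
    (z : E) (r : ℝ) :
    μ (Metric.ball z r) * ν Ω ≤ ν (Metric.ball 0 (r + R)) := by
  have hind : Measurable (Ω.indicator fun _ => (1 : ℝ≥0∞)) := measurable_const.indicator hmeas
  have hswap :
      ∫⁻ x in Metric.ball z (r + R), ∫⁻ t, Ω.indicator (fun _ => (1 : ℝ≥0∞)) (x - t) ∂μ ∂ν
        = ∫⁻ t, ∫⁻ x in Metric.ball z (r + R), Ω.indicator (fun _ => (1 : ℝ≥0∞)) (x - t) ∂ν ∂μ :=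
    lintegral_lintegral_swap (hind.comp (measurable_fst.sub measurable_snd)).aemeasurable
  have hslice (t : E) (ht : t ∈ Metric.ball z r) :
      ∫⁻ x in Metric.ball z (r + R), Ω.indicator (fun _ => (1 : ℝ≥0∞)) (x - t) ∂ν = ν Ω := by
    rw [setLIntegral_eq_of_support_subset]
    · rw [lintegral_sub_right_eq_self (fun x => Ω.indicator (fun _ => (1 : ℝ≥0∞)) x) t]
      simp [lintegral_indicator hmeas]
    · intro x hx
      have hxt : x - t ∈ Ω := by
        by_contra h
        simp [h] at hx
      have h₁ := mem_closedBall_zero_iff.1 (hR hxt)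
      have h₂ := dist_triangle x t z
      rw [Metric.mem_ball] at ht ⊢
      rw [dist_eq_norm x t] at h₂
      linarith
  calc
    μ (Metric.ball z r) * ν Ω = ∫⁻ _ in Metric.ball z r, ν Ω ∂μ := by
      rw [setLIntegral_const, mul_comm]
    _ = ∫⁻ t in Metric.ball z r,
          ∫⁻ x in Metric.ball z (r + R), Ω.indicator (fun _ => (1 : ℝ≥0∞)) (x - t) ∂ν ∂μ :=
      setLIntegral_congr_fun Metric.isOpen_ball.measurableSet fun t ht => (hslice t ht).symm
    _ ≤ ∫⁻ t, ∫⁻ x in Metric.ball z (r + R), Ω.indicator (fun _ => (1 : ℝ≥0∞)) (x - t) ∂ν ∂μ :=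
      setLIntegral_le_lintegral _ _
    _ ≤ ∫⁻ _ in Metric.ball z (r + R), 1 ∂ν := by
      rw [← hswap]
      exact lintegral_mono_ae (ae_restrict_of_ae hle)
    _ = ν (Metric.ball 0 (r + R)) := by
      rw [setLIntegral_one, Measure.addHaar_ball_center]

/-- If `Ω` is a bounded measurable set of positive measure and `μ` is a positive locally finite
measure with `1_Ω ∗ μ ≤ 1` a.e., then `μ` is translation-bounded: for every open ball `B`,
`sup_x μ(B + x) < ∞`. -/
theorem translation_bounded_of_weak_packing
    (d : ℕ) (Ω : Set (EuclideanSpace ℝ (Fin d)))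
    (hbd : Bornology.IsBounded Ω) (hmeas : MeasurableSet Ω) (hpos : 0 < volume Ω)
    (μ : Measure (EuclideanSpace ℝ (Fin d))) (hμ : IsLocallyFiniteMeasure μ)
    (hle : ∀ᵐ x ∂(volume : Measure (EuclideanSpace ℝ (Fin d))),
      (∫⁻ t, Set.indicator Ω (fun _ => (1 : ℝ≥0∞)) (x - t) ∂μ) ≤ 1) :
    ∀ (c : EuclideanSpace ℝ (Fin d)) (r : ℝ),
      (⨆ x : EuclideanSpace ℝ (Fin d), μ ((fun y => y + x) '' Metric.ball c r)) < ⊤ := by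
  intro c r
  obtain ⟨R, hR⟩ := hbd.subset_closedBall 0
  refine lt_of_le_of_lt (iSup_le fun x => ?_)
    (ENNReal.div_lt_top (measure_ball_lt_top (μ := volume)
      (x := (0 : EuclideanSpace ℝ (Fin d))) (r := r + R)).ne hpos.ne')
  have himage : (fun y => y + x) '' Metric.ball c r = Metric.ball (c + x) r := by
    simp
  rw [himage, ENNReal.le_div_iff_mul_le (Or.inl hpos.ne') (Or.inl hbd.measure_lt_top.ne)]
  exact measure_ball_mul_volume_le_of_lintegral_indicator_le_one hR hmeas hle (c + x) r
end
end

section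
/- Let Ω ⊂ ℝ^d be a bounded measurable set, let Σ ⊂ ℝ^d be a measurable set, and let μ be a positive locally finite Borel measure on ℝ^d such that (1_Ω ∗ μ)(x) = 0 for Lebesgue-a.e. x in the complement Σ^c of Σ. Then m((Ω + t) ∩ Σ^c) = 0 for every t in the support of μ, where m denotes Lebesgue measure. -/
open MeasureTheory Set Filter
open scoped ENNReal

noncomputable section

open Topology in
/-- Translates of a measurable set of finite measure vary continuously in measure. -/
theorem tendsto_measure_symmDiff_preimage_sub {G : Type*} [AddGroup G] [TopologicalSpace G]
    [IsTopologicalAddGroup G] [R1Space G] [MeasurableSpace G] [BorelSpace G]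
    (ν : Measure G) [ν.IsAddRightInvariant] [IsLocallyFiniteMeasure ν]
    [ν.InnerRegularCompactLTTop] {A : Set G} (hA : MeasurableSet A) (hfin : ν A ≠ ∞) (t : G) :
    Tendsto (fun s => ν (symmDiff ((fun x => x - s) ⁻¹' A) ((fun x => x - t) ⁻¹' A)))
      (𝓝 t) (𝓝 0) := by
  let F : C(G × G, G) := ⟨fun p => p.2 - p.1, continuous_snd.sub continuous_fst⟩
  have hF (s : G) : MeasurePreserving (F.curry s) ν ν := measurePreserving_sub_right ν s
  have hlim : Tendsto F.curry (𝓝 t) (𝓝 (F.curry t)) := F.curry.continuous.tendsto t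
  exact tendsto_measure_symmDiff_preimage_nhds_zero (f := F.curry) (g := F.curry t) (s := A)
    (μ := ν) (ν := ν) hlim (Eventually.of_forall hF) (hF t) hA.nullMeasurableSet hfin

/-- If the convolution of the indicator of `A` with `μ` vanishes `ν`-almost everywhere, then
`μ`-almost every translate of `A` is `ν`-null. -/
theorem ae_measure_preimage_sub_eq_zero {G : Type*} [AddGroup G] [MeasurableSpace G]
    [MeasurableSub₂ G] {μ ν : Measure G} [SFinite μ] [SFinite ν] {A : Set G}
    (hA : MeasurableSet A)
    (hzero : ∀ᵐ x ∂ν, ∫⁻ t, A.indicator (fun _ => (1 : ℝ≥0∞)) (x - t) ∂μ = 0) :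
    ∀ᵐ t ∂μ, ν ((fun x => x - t) ⁻¹' A) = 0 := by
  have hm : Measurable fun p : G × G => A.indicator (fun _ => (1 : ℝ≥0∞)) (p.1 - p.2) :=
    (measurable_const.indicator hA).comp measurable_sub
  have hint : ∫⁻ t, ν ((fun x => x - t) ⁻¹' A) ∂μ = 0 := by
    calc ∫⁻ t, ν ((fun x => x - t) ⁻¹' A) ∂μ
        = ∫⁻ t, ∫⁻ x, A.indicator (fun _ => (1 : ℝ≥0∞)) (x - t) ∂ν ∂μ := by
          refine lintegral_congr fun t => ?_
          rw [← lintegral_indicator_one (hA.preimage (measurable_sub_const t))]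
          rfl
      _ = ∫⁻ x, ∫⁻ t, A.indicator (fun _ => (1 : ℝ≥0∞)) (x - t) ∂μ ∂ν :=
          (lintegral_lintegral_swap hm.aemeasurable).symm
      _ = 0 := by rw [lintegral_congr_ae hzero, lintegral_zero]
  refine (lintegral_eq_zero_iff ?_).1 hint
  exact measurable_measure_prodMk_right (μ := ν) (hA.preimage measurable_sub)

/-- If `1_Ω ∗ μ = 0` a.e. on the complement of `S`, then `m((Ω + t) ∩ Sᶜ) = 0` for every
`t` in the support of `μ` (every point whose open neighborhoods all have positive `μ`-measure). -/
theorem translate_ae_subset_of_support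
    (d : ℕ) (Ω S : Set (EuclideanSpace ℝ (Fin d)))
    (hbd : Bornology.IsBounded Ω) (hmeas : MeasurableSet Ω) (hSmeas : MeasurableSet S)
    (μ : Measure (EuclideanSpace ℝ (Fin d))) (hμ : IsLocallyFiniteMeasure μ)
    (hzero : ∀ᵐ x ∂((volume : Measure (EuclideanSpace ℝ (Fin d))).restrict Sᶜ),
      (∫⁻ t, Set.indicator Ω (fun _ => (1 : ℝ≥0∞)) (x - t) ∂μ) = 0) :
    ∀ t : EuclideanSpace ℝ (Fin d),
      (∀ U : Set (EuclideanSpace ℝ (Fin d)), IsOpen U → t ∈ U → 0 < μ U) →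
      volume (((fun y => y + t) '' Ω) ∩ Sᶜ) = 0 := by
  intro t ht
  rw [image_add_right, ← nonpos_iff_eq_zero]
  simp only [← sub_eq_add_neg]
  refine le_of_forall_pos_le_add fun ε hε => ?_
  obtain ⟨U, hUsub, hUo, htU⟩ := eventually_nhds_iff.1
    ((tendsto_measure_symmDiff_preimage_sub volume hmeas hbd.measure_lt_top.ne t).eventually_lt_const
      hε)
  obtain ⟨s, hsU, hs⟩ : ∃ s ∈ U, (volume.restrict Sᶜ) ((fun x => x - s) ⁻¹' Ω) = 0 :=
    ((frequently_ae_mem_iff.2 (ht U hUo htU).ne').and_eventually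
      (ae_measure_preimage_sub_eq_zero hmeas hzero)).exists
  rw [Measure.restrict_apply' hSmeas.compl] at hs
  calc volume ((fun x => x - t) ⁻¹' Ω ∩ Sᶜ)
      ≤ volume ((fun x => x - s) ⁻¹' Ω ∩ Sᶜ ∪
          symmDiff ((fun x => x - s) ⁻¹' Ω) ((fun x => x - t) ⁻¹' Ω)) := by
        refine measure_mono fun x hx => ?_
        by_cases h : x ∈ (fun x => x - s) ⁻¹' Ω
        · exact Or.inl ⟨h, hx.2⟩
        · exact Or.inr (Or.inr ⟨hx.1, h⟩)
    _ ≤ 0 + ε := (measure_union_le _ _).trans (add_le_add hs.le (hUsub s hsU).le)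
end
end

section
/- Let Ω ⊂ ℝ^d be a bounded measurable set of positive Lebesgue measure, and let μ be a positive locally finite Borel measure on ℝ^d such that (1_Ω ∗ μ)(x) = 1_{Ω^c}(x) for Lebesgue-a.e. x. Then the support of μ is contained in the complement of Δ(Ω); that is, for every t in the support of μ one has m(Ω ∩ (Ω + t)) = 0. -/
open MeasureTheory Set Filter
open scoped ENNReal

noncomputable section

/-- A set of positive measure which overlaps its translate by `t` in positive measure also does so
for all translates by vectors near `t`. -/
lemma eventually_measure_inter_preimage_sub_ne_zero {G : Type*} [NormedAddCommGroup G]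
    [MeasurableSpace G] [BorelSpace G] [ProperSpace G] {ν : Measure G} [ν.IsAddHaarMeasure]
    {s : Set G} (hs : MeasurableSet s) (hfin : ν s ≠ ∞) {t : G}
    (ht : ν (s ∩ (fun y => y - t) ⁻¹' s) ≠ 0) :
    ∀ᶠ u in nhds t, ν (s ∩ (fun y => y - u) ⁻¹' s) ≠ 0 := by
  let f : C(G, C(G, G)) := ContinuousMap.curry ⟨fun p : G × G => p.2 - p.1, by fun_prop⟩
  have hf (u : G) : MeasurePreserving (f u) ν ν := measurePreserving_sub_right ν u
  have hlim := tendsto_measure_symmDiff_preimage_nhds_zero (f.continuous.tendsto t)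
    (.of_forall hf) (hf t) hs.nullMeasurableSet hfin
  filter_upwards [hlim.eventually_lt_const (pos_iff_ne_zero.2 ht)] with u hu hzero
  have hsub : s ∩ (fun y => y - t) ⁻¹' s ⊆
      (s ∩ (fun y => y - u) ⁻¹' s) ∪ symmDiff (f u ⁻¹' s) (f t ⁻¹' s) := by
    rintro y ⟨hy, hyt⟩
    by_cases hyu : y - u ∈ s
    · exact .inl ⟨hy, hyu⟩
    · exact .inr (.inr ⟨hyt, hyu⟩)
  have hle := (measure_mono (μ := ν) hsub).trans (measure_union_le _ _)
  rw [hzero, zero_add] at hle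
  exact hle.not_gt hu

/-- If the convolution `1_s ∗ μ` vanishes almost everywhere on `s`, then the translates of `s` by
`μ`-almost every vector meet `s` in a null set. -/
lemma ae_measure_inter_preimage_sub_eq_zero {G : Type*} [AddGroup G] [MeasurableSpace G]
    [MeasurableSub₂ G] {ν μ : Measure G} [SFinite ν] [SFinite μ] {s : Set G}
    (hs : MeasurableSet s)
    (h : ∀ᵐ x ∂ν, x ∈ s → ∫⁻ t, s.indicator (fun _ => (1 : ℝ≥0∞)) (x - t) ∂μ = 0) :
    ∀ᵐ t ∂μ, ν (s ∩ (fun y => y - t) ⁻¹' s) = 0 := by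
  have hm : Measurable fun p : G × G => s.indicator (fun _ => (1 : ℝ≥0∞)) (p.1 - p.2) :=
    (measurable_const.indicator hs).comp measurable_sub
  have hzero : ∫⁻ t, ∫⁻ x in s, s.indicator (fun _ => (1 : ℝ≥0∞)) (x - t) ∂ν ∂μ = 0 := by
    rw [← lintegral_lintegral_swap hm.aemeasurable, setLIntegral_congr_fun_ae hs h,
      lintegral_zero]
  rw [lintegral_eq_zero_iff hm.lintegral_prod_left'] at hzero
  filter_upwards [hzero] with t ht
  have hst : MeasurableSet ((fun y => y - t) ⁻¹' s) := hs.preimage (measurable_sub_const t)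
  change ∫⁻ x, ((fun y => y - t) ⁻¹' s).indicator (fun _ => (1 : ℝ≥0∞)) x ∂ν.restrict s = 0 at ht
  rwa [lintegral_indicator_const hst, one_mul, Measure.restrict_apply hst, inter_comm] at ht

/-- If `1_Ω ∗ μ = 1_{Ωᶜ}` a.e. (a weak tiling of the complement of `Ω` by translates of `Ω`),
then the support of `μ` is contained in the complement of `Δ(Ω)`: for every `t` in the
support of `μ`, `m(Ω ∩ (Ω + t)) = 0`. -/
theorem support_subset_compl_delta
    (d : ℕ) (Ω : Set (EuclideanSpace ℝ (Fin d)))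
    (hbd : Bornology.IsBounded Ω) (hmeas : MeasurableSet Ω) (hpos : 0 < volume Ω)
    (μ : Measure (EuclideanSpace ℝ (Fin d))) (hμ : IsLocallyFiniteMeasure μ)
    (htile : ∀ᵐ x ∂(volume : Measure (EuclideanSpace ℝ (Fin d))),
      (∫⁻ t, Set.indicator Ω (fun _ => (1 : ℝ≥0∞)) (x - t) ∂μ) =
        Set.indicator Ωᶜ (fun _ => (1 : ℝ≥0∞)) x) :
    ∀ t : EuclideanSpace ℝ (Fin d),
      (∀ U : Set (EuclideanSpace ℝ (Fin d)), IsOpen U → t ∈ U → 0 < μ U) →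
      volume (Ω ∩ ((fun y => y + t) '' Ω)) = 0 := by
  intro t ht
  have himage : (fun y => y + t) '' Ω = (fun y => y - t) ⁻¹' Ω := by
    simp [sub_eq_add_neg]
  rw [himage]
  by_contra hne
  have hnear := eventually_measure_inter_preimage_sub_ne_zero hmeas hbd.measure_lt_top.ne hne
  obtain ⟨U, hU, hUo, htU⟩ := eventually_nhds_iff.1 hnear
  have hae : ∀ᵐ u ∂μ, volume (Ω ∩ (fun y => y - u) ⁻¹' Ω) = 0 := by
    refine ae_measure_inter_preimage_sub_eq_zero hmeas ?_
    filter_upwards [htile] with x hx hxΩ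
    simpa [hxΩ] using hx
  exact (ht U hUo htU).ne' (measure_mono_null hU (ae_iff.1 hae))
end
end

section
/- Let K be a convex body in ℝ^d which is not a convex polytope (i.e. K is not the convex hull of any finite set of points). Then there exists an infinite sequence (x_n) of regular boundary points of K whose exterior normal unit vectors ξ_n are pairwise distinct: ξ_n ≠ ξ_m whenever n ≠ m. -/
open MeasureTheory Set Filter
open scoped RealInnerProductSpace

noncomputable section

/-- `x` is a regular boundary point of `K` with exterior normal unit vector `ξ`:
`x ∈ ∂K`, `ξ` is a unit outer normal at `x`, and it is the unique such unit vector. -/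
def IsRegularPointWithNormal {d : ℕ} (K : Set (EuclideanSpace ℝ (Fin d)))
    (x ξ : EuclideanSpace ℝ (Fin d)) : Prop :=
  x ∈ frontier K ∧ ‖ξ‖ = 1 ∧ (∀ z ∈ K, ⟪z, ξ⟫ ≤ ⟪x, ξ⟫) ∧
    ∀ η : EuclideanSpace ℝ (Fin d), ‖η‖ = 1 → (∀ z ∈ K, ⟪z, η⟫ ≤ ⟪x, η⟫) → η = ξ

section Helpers

variable {E : Type*} [NormedAddCommGroup E] [InnerProductSpace ℝ E]

/-- If a closed ball around `c` lies in `K`, then every support functional of `K` in a unit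
direction `η` exceeds its value at `c` by at least the radius. -/
theorem inner_add_le_of_closedBall_subset {K : Set E} {c η : E} {r a : ℝ} (hr : 0 ≤ r)
    (hball : Metric.closedBall c r ⊆ K) (hη : ‖η‖ = 1) (ha : ∀ z ∈ K, ⟪z, η⟫ ≤ a) :
    ⟪c, η⟫ + r ≤ a := by
  have h := ha (c + r • η) (hball (by simp [norm_smul, hη, abs_of_nonneg hr]))
  rwa [inner_add_left, real_inner_smul_left, real_inner_self_eq_norm_sq, hη, one_pow,
    mul_one] at h

/-- At a point where an inscribed ball touches the boundary, the only unit outer normal is the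
radial direction. -/
theorem eq_smul_sub_of_closedBall_subset {K : Set E} {c x η : E} {r : ℝ} (hr : 0 < r)
    (hball : Metric.closedBall c r ⊆ K) (hx : dist c x = r) (hη : ‖η‖ = 1)
    (hsupp : ∀ z ∈ K, ⟪z, η⟫ ≤ ⟪x, η⟫) : η = r⁻¹ • (x - c) := by
  have h := inner_add_le_of_closedBall_subset hr.le hball hη hsupp
  have hn : ‖x - c‖ = r := by rw [← hx, dist_comm, dist_eq_norm]
  have h1 : ‖r⁻¹ • (x - c)‖ = 1 := by
    rw [norm_smul, hn, Real.norm_of_nonneg (by positivity), inv_mul_cancel₀ hr.ne']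
  have h2 : r ≤ ⟪x - c, η⟫ := by rw [inner_sub_left]; linarith
  have h3 : ⟪r⁻¹ • (x - c), η⟫ = 1 := by
    apply le_antisymm
    · simpa [h1, hη] using real_inner_le_norm (r⁻¹ • (x - c)) η
    · rw [real_inner_smul_left, ← inv_mul_cancel₀ hr.ne']
      gcongr
  exact ((inner_eq_one_iff_of_norm_eq_one h1 hη).1 h3).symm

/-- A convex set with nonempty interior has a unit outer normal at every boundary point. -/
theorem exists_unit_normal_of_mem_frontier [CompleteSpace E] {K : Set E} (hconv : Convex ℝ K)
    (hint : (interior K).Nonempty) {x : E} (hx : x ∈ frontier K) :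
    ∃ η : E, ‖η‖ = 1 ∧ ∀ z ∈ K, ⟪z, η⟫ ≤ ⟪x, η⟫ := by
  obtain ⟨f, hf⟩ := geometric_hahn_banach_open_point hconv.interior isOpen_interior hx.2
  obtain ⟨p, hp⟩ := hint
  set v := (InnerProductSpace.toDual ℝ E).symm f with hv
  have hfv : ∀ z, f z = ⟪z, v⟫ := fun z => by
    rw [real_inner_comm, hv, InnerProductSpace.toDual_symm_apply]
  have hv0 : v ≠ 0 := fun h => by
    have := hf p hp
    simp [hfv, h] at this
  have hle : ∀ z ∈ K, f z ≤ f x := fun z hz => by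
    have hz' : z ∈ closure (interior K) := by
      rw [hconv.closure_interior_eq_closure_of_nonempty_interior ⟨p, hp⟩]
      exact subset_closure hz
    exact closure_minimal (fun w hw => (hf w hw).le)
      (isClosed_le f.continuous continuous_const) hz'
  refine ⟨‖v‖⁻¹ • v, norm_smul_inv_norm hv0, fun z hz => ?_⟩
  rw [real_inner_smul_right, real_inner_smul_right, ← hfv, ← hfv]
  exact mul_le_mul_of_nonneg_left (hle z hz) (by positivity)

/-- A compact convex set cut out by finitely many linear inequalities is the convex hull of
finitely many points. -/
theorem exists_finite_eq_convexHull_of_finite_halfspaces [FiniteDimensional ℝ E] {K : Set E}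
    (hK : IsCompact K) (hconv : Convex ℝ K) {N : Set E} (hN : N.Finite) (h : E → ℝ)
    (hKN : K = {z | ∀ ξ ∈ N, ⟪z, ξ⟫ ≤ h ξ}) :
    ∃ S : Set E, S.Finite ∧ K = convexHull ℝ S := by
  have hfin : (K.extremePoints ℝ).Finite := by
    refine Set.Finite.of_finite_image (f := fun e => {ξ ∈ N | ⟪e, ξ⟫ = h ξ})
      (hN.finite_subsets.subset ?_) ?_
    · rintro _ ⟨e, -, rfl⟩
      exact sep_subset _ _
    intro e he e' he' hact
    have hactive : ∀ ξ ∈ N, ⟪e, ξ⟫ = h ξ → ⟪e' - e, ξ⟫ = 0 := fun ξ hξ heq => by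
      have : ξ ∈ {ξ ∈ N | ⟪e', ξ⟫ = h ξ} :=
        (Set.ext_iff.1 hact ξ).1 ⟨hξ, heq⟩
      rw [inner_sub_left, this.2, heq, sub_self]
    have hev : ∀ᶠ t : ℝ in nhds 0, e + t • (e' - e) ∈ K := by
      rw [hKN]
      refine (hN.eventually_all).2 fun ξ hξ => ?_
      have heK := he.1
      rw [hKN] at heK
      rcases (heK ξ hξ).eq_or_lt with heq | hlt
      · refine Eventually.of_forall fun t => ?_
        rw [inner_add_left, real_inner_smul_left, hactive ξ hξ heq, mul_zero, add_zero]
        exact heq.le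
      · have hc : ContinuousAt (fun t : ℝ => ⟪e + t • (e' - e), ξ⟫) 0 := by fun_prop
        exact (hc.eventually_lt continuousAt_const (by simpa using hlt)).mono fun t ht => ht.le
    obtain ⟨δ, hδ, hball⟩ := Metric.eventually_nhds_iff.1 hev
    have hp := hball (y := δ / 2) (by simp [abs_of_pos hδ]; linarith)
    have hm := hball (y := -(δ / 2)) (by simp [abs_of_pos hδ]; linarith)
    have hseg : e ∈ openSegment ℝ (e + (δ / 2) • (e' - e)) (e + (-(δ / 2)) • (e' - e)) :=
      ⟨1 / 2, 1 / 2, by norm_num, by norm_num, by norm_num, by module⟩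
    have := he.2 hp hm hseg
    have h0 : (δ / 2) • (e' - e) = 0 := by simpa using this
    rcases smul_eq_zero.1 h0 with h0 | h0
    · linarith
    · exact (sub_eq_zero.1 h0).symm
  refine ⟨_, hfin, ?_⟩
  rw [← (hfin.isCompact_convexHull (𝕜 := ℝ)).isClosed.closure_eq]
  exact (closure_convexHull_extremePoints hK hconv).symm

end Helpers

/-- Around every interior point of a convex body the largest inscribed ball touches the boundary
at a regular point. -/
theorem exists_regular_of_mem_interior {d : ℕ} {K : Set (EuclideanSpace ℝ (Fin d))}
    (hbody : IsConvexBody K) (hne : Kᶜ.Nonempty) {c : EuclideanSpace ℝ (Fin d)}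
    (hc : c ∈ interior K) :
    ∃ x ξ, IsRegularPointWithNormal K x ξ ∧ ⟪x, ξ⟫ = ⟪c, ξ⟫ + Metric.infDist c Kᶜ := by
  obtain ⟨hK, hconv, hint⟩ := hbody
  obtain ⟨x, hx, hxd⟩ := isClosed_closure.exists_infDist_eq_dist hne.closure c
  rw [Metric.infDist_closure] at hxd
  set r := Metric.infDist c Kᶜ with hr
  have hr0 : 0 < r := by
    rw [hr, ← Metric.infDist_closure]
    refine (isClosed_closure.notMem_iff_infDist_pos hne.closure).1 ?_
    rwa [closure_compl, notMem_compl_iff]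
  have hball : Metric.closedBall c r ⊆ K := by
    rw [← closure_ball c hr0.ne']
    refine closure_minimal ?_ hK.isClosed
    simpa using Metric.ball_infDist_compl_subset (s := K) (x := c)
  have hxK : x ∈ K := hball (by rw [Metric.mem_closedBall, dist_comm, hxd])
  have hxf : x ∈ frontier K := by
    rw [frontier_eq_closure_inter_closure]
    exact ⟨subset_closure hxK, hx⟩
  obtain ⟨ξ, hξ, hsupp⟩ := exists_unit_normal_of_mem_frontier hconv hint hxf
  have hrad := eq_smul_sub_of_closedBall_subset hr0 hball hxd.symm hξ hsupp
  refine ⟨x, ξ, ⟨hxf, hξ, hsupp, fun η hη hη' => ?_⟩, ?_⟩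
  · rw [hrad, eq_smul_sub_of_closedBall_subset hr0 hball hxd.symm hη hη']
  · have hxc : x - c = r • ξ := by rw [hrad, smul_inv_smul₀ hr0.ne']
    have : ⟪x - c, ξ⟫ = r := by
      rw [hxc, real_inner_smul_left, real_inner_self_eq_norm_sq, hξ, one_pow, mul_one]
    rw [inner_sub_left] at this
    linarith

/-- A convex body is the intersection of its support half-spaces at regular points. -/
theorem mem_of_forall_regular_inner_le {d : ℕ} {K : Set (EuclideanSpace ℝ (Fin d))}
    (hbody : IsConvexBody K) {y : EuclideanSpace ℝ (Fin d)}
    (hy : ∀ x ξ, IsRegularPointWithNormal K x ξ → ⟪y, ξ⟫ ≤ ⟪x, ξ⟫) : y ∈ K := by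
  by_contra hyK
  have hne : Kᶜ.Nonempty := ⟨y, hyK⟩
  obtain ⟨p, hp⟩ := hbody.2.2
  obtain ⟨ε, hε, hpε⟩ := Metric.nhds_basis_closedBall.mem_iff.1 (mem_interior_iff_mem_nhds.1 hp)
  set γ : ℝ → EuclideanSpace ℝ (Fin d) := fun t => AffineMap.lineMap p y t with hγ
  have hγc : Continuous γ := AffineMap.lineMap_continuous
  have hbound : ∀ t ∈ Icc (0 : ℝ) 1, γ t ∈ interior K →
      (1 - t) * ε ≤ Metric.infDist (γ t) Kᶜ := by
    intro t ht hmem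
    obtain ⟨x, ξ, hreg, hval⟩ := exists_regular_of_mem_interior hbody hne hmem
    have h1 := inner_add_le_of_closedBall_subset hε.le hpε hreg.2.1 hreg.2.2.1
    have h2 := hy x ξ hreg
    have h3 : ⟪γ t, ξ⟫ = (1 - t) * ⟪p, ξ⟫ + t * ⟪y, ξ⟫ := by
      simp only [hγ, AffineMap.lineMap_apply_module, inner_add_left, real_inner_smul_left]
    nlinarith [mul_le_mul_of_nonneg_left h1 (sub_nonneg.2 ht.2),
      mul_le_mul_of_nonneg_left h2 ht.1]
  have hmem_int : ∀ t < 1, (1 - t) * ε ≤ Metric.infDist (γ t) Kᶜ → γ t ∈ interior K := by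
    intro t ht hle
    have hpos : 0 < Metric.infDist (γ t) Kᶜ := (mul_pos (sub_pos.2 ht) hε).trans_le hle
    rw [← Metric.infDist_closure] at hpos
    have := (isClosed_closure.notMem_iff_infDist_pos hne.closure).2 hpos
    rwa [closure_compl, notMem_compl_iff] at this
  have hall : Icc (0 : ℝ) 1 ⊆ {t | (1 - t) * ε ≤ Metric.infDist (γ t) Kᶜ} := by
    refine IsClosed.Icc_subset_of_forall_mem_nhdsWithin ?_ ?_ ?_
    · exact (isClosed_le (by fun_prop)
        ((Metric.continuous_infDist_pt _).comp hγc)).inter isClosed_Icc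
    · exact hbound 0 (by simp) (by simpa [hγ] using hp)
    · rintro t ⟨htA, ht⟩
      have hnhds : ∀ᶠ s in nhds t, γ s ∈ interior K :=
        hγc.continuousAt.eventually_mem (isOpen_interior.mem_nhds (hmem_int t ht.2 htA))
      filter_upwards [nhdsWithin_le_nhds hnhds, Ioc_mem_nhdsGT ht.2] with s hs hs'
      exact hbound s ⟨ht.1.trans hs'.1.le, hs'.2⟩ hs
  have hlim : Tendsto γ (nhdsWithin 1 (Iio 1)) (nhds y) := by
    have : Tendsto γ (nhds 1) (nhds (γ 1)) := hγc.tendsto 1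
    simp only [hγ, AffineMap.lineMap_apply_one] at this
    exact this.mono_left nhdsWithin_le_nhds
  refine hyK (hbody.1.isClosed.mem_of_tendsto hlim ?_)
  filter_upwards [Ico_mem_nhdsLT (zero_lt_one (α := ℝ))] with t ht
  exact interior_subset (hmem_int t ht.2 (hall ⟨ht.1, ht.2.le⟩))

/-- A convex body which is not a polytope has an infinite sequence of regular boundary points
whose exterior unit normals are pairwise distinct. -/
theorem exists_regular_points_distinct_normals
    (d : ℕ) (K : Set (EuclideanSpace ℝ (Fin d)))
    (hbody : IsConvexBody K) (hnp : ¬ IsConvexPolytope K) :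
    ∃ (x ξ : ℕ → EuclideanSpace ℝ (Fin d)),
      (∀ n, IsRegularPointWithNormal K (x n) (ξ n)) ∧
      ∀ n m : ℕ, n ≠ m → ξ n ≠ ξ m := by
  set N := {ξ | ∃ x, IsRegularPointWithNormal K x ξ} with hN
  have hinf : N.Infinite := by
    intro hfin
    have hex : ∀ ξ, ∃ x, ξ ∈ N → IsRegularPointWithNormal K x ξ := fun ξ => by
      by_cases hξ : ξ ∈ N
      · exact hξ.imp fun x hx _ => hx
      · exact ⟨0, fun h => absurd h hξ⟩
    choose X hX using hex
    refine hnp (exists_finite_eq_convexHull_of_finite_halfspaces hbody.1 hbody.2.1 hfin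
      (fun ξ => ⟪X ξ, ξ⟫) (Subset.antisymm (fun z hz ξ hξ => (hX ξ hξ).2.2.1 z hz) ?_))
    intro y hy
    refine mem_of_forall_regular_inner_le hbody fun x ξ hreg => ?_
    have hξ : ξ ∈ N := ⟨x, hreg⟩
    exact (hy ξ hξ).trans (hreg.2.2.1 _ (hbody.1.isClosed.frontier_subset (hX ξ hξ).1))
  let f := hinf.natEmbedding
  choose x hx using fun n => (f n).2
  exact ⟨x, fun n => f n, hx, fun n m hnm h => hnm (f.injective (Subtype.ext h))⟩
end
end

section
/- Let K be a convex body in ℝ^d, let x be a regular boundary point of K, and let ξ be the exterior normal unit vector of K at x. Let U be an open set containing the set −S(K, −ξ) + x. Then there exists an open neighborhood V of x such that for every t ∈ ℝ^d with m(K ∩ (K + t)) = 0, if (K + t) ∩ V ≠ ∅ then t ∈ U. -/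
open MeasureTheory Set Filter
open scoped RealInnerProductSpace ENNReal

noncomputable section

/-- The support set `S(K, η) = {y ∈ K : ⟨y, η⟩ = sup_{z ∈ K} ⟨z, η⟩}`. -/
def SuppSet {d : ℕ} (K : Set (EuclideanSpace ℝ (Fin d))) (η : EuclideanSpace ℝ (Fin d)) :
    Set (EuclideanSpace ℝ (Fin d)) :=
  {y ∈ K | ∀ z ∈ K, ⟪z, η⟫ ≤ ⟪y, η⟫}

/-- A linear functional bounded above by `u` on the interior of a convex body is bounded above by
`u` on the whole body. -/
lemma IsConvexBody.le_of_interior_le {d : ℕ} {K : Set (EuclideanSpace ℝ (Fin d))}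
    (hK : IsConvexBody K) {f : EuclideanSpace ℝ (Fin d) → ℝ} (hf : Continuous f) {u : ℝ}
    (h : ∀ a ∈ interior K, f a ≤ u) {a : EuclideanSpace ℝ (Fin d)} (ha : a ∈ K) : f a ≤ u := by
  obtain ⟨hc, hconv, hne⟩ := hK
  have hcl : closure (interior K) ⊆ {a | f a ≤ u} :=
    closure_minimal h (isClosed_le hf continuous_const)
  rw [hconv.closure_interior_eq_closure_of_nonempty_interior hne] at hcl
  exact hcl (subset_closure ha)

/-- If `y ∈ K` and translating `K` by `x - y`, for a regular boundary point `x` of `K` with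
normal `ξ`, makes its interior disjoint from the interior of `K`, then `y` lies in the support
set of `K` opposite to `ξ`. -/
lemma mem_suppSet_neg_of_interior_disjoint {d : ℕ} {K : Set (EuclideanSpace ℝ (Fin d))}
    (hbody : IsConvexBody K) {x ξ y : EuclideanSpace ℝ (Fin d)}
    (hreg : IsRegularPointWithNormal K x ξ) (hy : y ∈ K)
    (hdisj : ∀ b ∈ interior K, b + (x - y) ∉ interior K) : y ∈ SuppSet K (-ξ) := by
  obtain ⟨hxf, -, -, huniq⟩ := hreg
  have hxK : x ∈ K := hbody.1.isClosed.frontier_subset hxf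
  have hd : Disjoint (interior K) ((fun b => b + (x - y)) '' interior K) := by
    rw [Set.disjoint_right]
    rintro _ ⟨b, hb, rfl⟩
    exact hdisj b hb
  have hconv : Convex ℝ ((fun b => b + (x - y)) '' interior K) := by
    simpa only [add_comm] using hbody.2.1.interior.translate (x - y)
  obtain ⟨f, u, hfu, huf⟩ := geometric_hahn_banach_open_open hbody.2.1.interior isOpen_interior
    hconv
    ((Homeomorph.addRight (x - y)).isOpenMap _ isOpen_interior) hd
  have hle : ∀ a ∈ K, f a ≤ u := fun a ha =>
    hbody.le_of_interior_le f.continuous (fun a ha => (hfu a ha).le) ha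
  have hge : ∀ b ∈ K, -f (b + (x - y)) ≤ -u := fun b hb =>
    hbody.le_of_interior_le (f := fun b => -f (b + (x - y))) (by fun_prop)
      (fun b hb => neg_le_neg (huf _ ⟨b, hb, rfl⟩).le) hb
  have hfx : f x = u := by
    have h₁ := hge y hy
    rw [add_sub_cancel] at h₁
    linarith [hle x hxK]
  set η := (InnerProductSpace.toDual ℝ (EuclideanSpace ℝ (Fin d))).symm f with hη
  have hfη : ∀ z, f z = ⟪z, η⟫ := fun z => by
    rw [real_inner_comm, hη, InnerProductSpace.toDual_symm_apply]
  have hη0 : η ≠ 0 := by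
    intro h0
    obtain ⟨a, ha⟩ := hbody.2.2
    have h₁ := hfu a ha
    have h₂ := huf _ ⟨a, ha, rfl⟩
    simp only [hfη, h0, inner_zero_right] at h₁ h₂
    linarith
  have hpos : 0 < ‖η‖ := norm_pos_iff.mpr hη0
  have hξ : ‖η‖⁻¹ • η = ξ := by
    refine huniq _ (by rw [norm_smul, norm_inv, norm_norm, inv_mul_cancel₀ hpos.ne']) ?_
    intro z hz
    rw [real_inner_smul_right, real_inner_smul_right, ← hfη, ← hfη, hfx]
    exact mul_le_mul_of_nonneg_left (hle z hz) (inv_nonneg.mpr hpos.le)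
  refine ⟨hy, fun z hz => ?_⟩
  rw [← hξ, inner_neg_right, inner_neg_right, real_inner_smul_right, real_inner_smul_right,
    ← hfη, ← hfη, neg_le_neg_iff]
  refine mul_le_mul_of_nonneg_left ?_ (inv_nonneg.mpr hpos.le)
  have h₁ := hge z hz
  rw [map_add, map_sub] at h₁
  linarith

/-- Near a regular boundary point `x` of `K` with normal `ξ`, a translate `K + t` disjoint
from `K` in measure can only meet a small neighborhood `V` of `x` if `t` lies in the given
neighborhood `U` of `-S(K, -ξ) + x`. -/
theorem translate_near_regular_point
    (d : ℕ) (K : Set (EuclideanSpace ℝ (Fin d)))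
    (hbody : IsConvexBody K)
    (x ξ : EuclideanSpace ℝ (Fin d)) (hreg : IsRegularPointWithNormal K x ξ)
    (U : Set (EuclideanSpace ℝ (Fin d))) (hU : IsOpen U)
    (hUsub : (fun y => x - y) '' SuppSet K (-ξ) ⊆ U) :
    ∃ V : Set (EuclideanSpace ℝ (Fin d)), IsOpen V ∧ x ∈ V ∧
      ∀ t : EuclideanSpace ℝ (Fin d),
        volume (K ∩ ((fun y => y + t) '' K)) = 0 →
        (((fun y => y + t) '' K) ∩ V).Nonempty → t ∈ U := by
  set W : Set (EuclideanSpace ℝ (Fin d)) :=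
    U ∪ ⋃ b ∈ interior K, (fun t => b + t) ⁻¹' interior K
  have hWo : IsOpen W := hU.union <| isOpen_biUnion fun b _ =>
    isOpen_interior.preimage (by fun_prop)
  have hKW : K ×ˢ {x} ⊆ (fun p : _ × _ => p.2 - p.1) ⁻¹' W := by
    rintro ⟨y, v⟩ ⟨hy, hv⟩
    obtain rfl : v = x := hv
    by_cases h : ∀ b ∈ interior K, b + (v - y) ∉ interior K
    · exact Or.inl (hUsub ⟨y, mem_suppSet_neg_of_interior_disjoint hbody hreg hy h, rfl⟩)
    · push Not at h
      obtain ⟨b, hb, hbt⟩ := h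
      exact Or.inr (Set.mem_biUnion hb hbt)
  obtain ⟨A, V, -, hVo, hKA, hxV, hAV⟩ := generalized_tube_lemma hbody.1 isCompact_singleton
    (hWo.preimage (by fun_prop)) hKW
  refine ⟨V, hVo, hxV rfl, ?_⟩
  rintro t hvol ⟨_, ⟨y, hy, rfl⟩, hyV⟩
  have htW : t ∈ W := by
    have h := hAV (Set.mk_mem_prod (hKA hy) hyV)
    simpa only [Set.mem_preimage, add_sub_cancel_left] using h
  refine htW.resolve_right fun ht => ?_
  obtain ⟨b, hb, hbt⟩ := Set.mem_iUnion₂.mp ht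
  have hopen : IsOpen (interior K ∩ (fun y => y + t) '' interior K) :=
    isOpen_interior.inter ((Homeomorph.addRight t).isOpenMap _ isOpen_interior)
  refine (hopen.measure_pos volume ⟨b + t, hbt, b, hb, rfl⟩).ne' (measure_mono_null ?_ hvol)
  exact Set.inter_subset_inter interior_subset (Set.image_mono interior_subset)
end
end

section
/- Let K ⊂ ℝ^d be a convex body, and let μ be a positive locally finite Borel measure on ℝ^d such that (1_K ∗ μ)(x) = 1_{K^c}(x) for Lebesgue-a.e. x. Let x be a regular boundary point of K and ξ the exterior normal unit vector of K at x. Then μ(−S(K, −ξ) + x) ≥ 1. -/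
open MeasureTheory Set Filter
open scoped RealInnerProductSpace ENNReal

noncomputable section

section Lemmas

variable {d : ℕ} {K : Set (EuclideanSpace ℝ (Fin d))}

theorem lintegral_indicator_sub_eq_measure (hK : IsClosed K)
    (μ : Measure (EuclideanSpace ℝ (Fin d))) (y : EuclideanSpace ℝ (Fin d)) :
    (∫⁻ t, Set.indicator K (fun _ => (1 : ℝ≥0∞)) (y - t) ∂μ) = μ ((fun t => y - t) ⁻¹' K) :=
  lintegral_indicator_one (μ := μ) (hK.preimage (by fun_prop)).measurableSet

/-- An almost-everywhere property holds at some point of any nonempty open set. -/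
theorem exists_mem_of_ae_of_isOpen {p : EuclideanSpace ℝ (Fin d) → Prop}
    (hp : ∀ᵐ y ∂(volume : Measure (EuclideanSpace ℝ (Fin d))), p y)
    {U : Set (EuclideanSpace ℝ (Fin d))} (hU : IsOpen U) (hne : U.Nonempty) :
    ∃ y ∈ U, p y := by
  have hpos : ∃ᵐ y ∂(volume : Measure (EuclideanSpace ℝ (Fin d))), y ∈ U :=
    frequently_ae_iff.2 (hU.measure_pos volume hne).ne'
  exact (hpos.and_eventually hp).exists

/-- A measure that gives no mass to `y - K` for almost every `y ∈ K` vanishes on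
`interior K - interior K`. -/
theorem measure_interior_sub_interior_eq_zero_s15
    {μ : Measure (EuclideanSpace ℝ (Fin d))}
    (h : ∀ᵐ y ∂(volume : Measure (EuclideanSpace ℝ (Fin d))),
      y ∈ K → μ ((fun t => y - t) ⁻¹' K) = 0) :
    μ {p | ∃ a ∈ interior K, ∃ b ∈ interior K, p = a - b} = 0 := by
  refine measure_null_of_locally_null _ ?_
  rintro _ ⟨a, ha, b, hb, rfl⟩
  obtain ⟨r, hr, hrK⟩ := Metric.mem_nhds_iff.1 (mem_interior_iff_mem_nhds.1 hb)
  obtain ⟨y, ⟨hyK, hya⟩, hy⟩ := exists_mem_of_ae_of_isOpen h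
    (isOpen_interior.inter (Metric.isOpen_ball (x := a) (ε := r / 2)))
    ⟨a, ha, Metric.mem_ball_self (half_pos hr)⟩
  refine ⟨Metric.ball (a - b) (r / 2),
    mem_nhdsWithin_of_mem_nhds (Metric.ball_mem_nhds _ (half_pos hr)),
    measure_mono_null (t := (fun t => y - t) ⁻¹' K) (fun t ht => hrK ?_)
      (hy (interior_subset hyK))⟩
  rw [Metric.mem_ball, dist_eq_norm] at hya ht ⊢
  calc ‖y - t - b‖ = ‖(y - a) - (t - (a - b))‖ := by congr 1; abel
    _ ≤ ‖y - a‖ + ‖t - (a - b)‖ := norm_sub_le _ _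
    _ < r := by linarith

/-- If `μ (y - K) ≥ 1` for points `y` arbitrarily close to `x`, then `μ (x - K) ≥ 1`. -/
theorem one_le_measure_sub_of_frequently (hK : IsCompact K)
    (μ : Measure (EuclideanSpace ℝ (Fin d))) [IsLocallyFiniteMeasure μ]
    {x : EuclideanSpace ℝ (Fin d)}
    (h : ∀ δ > 0, ∃ y ∈ Metric.ball x δ, 1 ≤ μ ((fun t => y - t) ⁻¹' K)) :
    1 ≤ μ ((fun y => x - y) '' K) := by
  by_contra! hlt
  obtain ⟨U, hU, hUo, hU1⟩ := Set.exists_isOpen_lt_of_lt _ _ hlt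
  have hC : IsCompact ((fun y => x - y) '' K) := hK.image (by fun_prop)
  obtain ⟨δ, hδ, hδU⟩ := hC.exists_thickening_subset_open hUo hU
  obtain ⟨y, hy, hy1⟩ := h δ hδ
  refine (hy1.trans (measure_mono fun t ht => hδU ?_)).not_gt hU1
  refine Metric.mem_thickening_iff.2 ⟨x - (y - t), ⟨y - t, ht, rfl⟩, ?_⟩
  rw [Metric.mem_ball, dist_eq_norm] at hy
  rw [dist_eq_norm]
  convert hy using 2
  abel

/-- If `x` is regular with normal `ξ` and `x - k` is not in `interior K - interior K`, then `k`
lies in the support set of `K` in direction `-ξ`. -/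
theorem mem_suppSet_of_sub_notMem (hbody : IsConvexBody K)
    {x ξ k : EuclideanSpace ℝ (Fin d)} (hreg : IsRegularPointWithNormal K x ξ) (hk : k ∈ K)
    (hxk : x - k ∉ {p | ∃ a ∈ interior K, ∃ b ∈ interior K, p = a - b}) :
    k ∈ SuppSet K (-ξ) := by
  obtain ⟨hcomp, hconv, hne⟩ := hbody
  obtain ⟨hxf, -, -, huniq⟩ := hreg
  have hxK : x ∈ K := hcomp.isClosed.frontier_subset hxf
  have hdense : K ⊆ closure (interior K) := by
    rw [hconv.closure_interior_eq_closure_of_nonempty_interior hne]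
    exact subset_closure
  have hdisj : Disjoint (interior K) ((fun z => z + (k - x)) ⁻¹' interior K) := by
    refine Set.disjoint_left.2 fun a ha hb => hxk ⟨a, ha, a + (k - x), hb, ?_⟩
    rw [sub_add_cancel_left, neg_sub]
  obtain ⟨f, u, hfl, hfr⟩ := geometric_hahn_banach_open_open hconv.interior isOpen_interior
    (hconv.interior.translate_preimage_left (k - x))
    (isOpen_interior.preimage (by fun_prop)) hdisj
  have hle : ∀ z ∈ K, f z ≤ u := fun z hz =>
    closure_minimal (fun a ha => (hfl a ha).le)
      (isClosed_le f.continuous continuous_const) (hdense hz)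
  have hge : ∀ z ∈ K, u ≤ f (z + (x - k)) := fun z hz =>
    closure_minimal
      (fun a ha => (hfr (a + (x - k)) (by
        rw [Set.mem_preimage]; convert ha using 1; abel)).le)
      (isClosed_le continuous_const (f.continuous.comp (by fun_prop))) (hdense hz)
  have hfx : f x = u := le_antisymm (hle x hxK) (by simpa using hge k hk)
  set v := (InnerProductSpace.toDual ℝ (EuclideanSpace ℝ (Fin d))).symm f with hv
  have hfv : ∀ z, f z = ⟪z, v⟫ := fun z => by
    rw [real_inner_comm, hv, InnerProductSpace.toDual_symm_apply]
  have hv0 : v ≠ 0 := by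
    intro h0
    obtain ⟨a, ha⟩ := hne
    have := hfl a ha
    rw [← hfx, hfv, hfv, h0] at this
    simp at this
  have hvpos : 0 < ‖v‖ := norm_pos_iff.2 hv0
  have hξ : ‖v‖⁻¹ • v = ξ := by
    refine huniq _ (by rw [norm_smul, norm_inv, norm_norm, inv_mul_cancel₀ hvpos.ne']) ?_
    intro z hz
    rw [real_inner_smul_right, real_inner_smul_right, ← hfv, ← hfv, hfx]
    exact mul_le_mul_of_nonneg_left (hle z hz) (inv_nonneg.2 hvpos.le)
  refine ⟨hk, fun z hz => ?_⟩
  rw [inner_neg_right, inner_neg_right, neg_le_neg_iff, ← hξ, real_inner_smul_right,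
    real_inner_smul_right, ← hfv, ← hfv]
  refine mul_le_mul_of_nonneg_left ?_ (inv_nonneg.2 hvpos.le)
  have := hge z hz
  rw [map_add, map_sub, hfx] at this
  linarith

end Lemmas

/-- If `μ` provides a weak tiling of the complement of a convex body `K` by translates of `K`,
then for any regular boundary point `x` of `K` with exterior unit normal `ξ`,
`μ(-S(K, -ξ) + x) ≥ 1`. -/
theorem weak_tiling_measure_of_support_set
    (d : ℕ) (K : Set (EuclideanSpace ℝ (Fin d)))
    (hbody : IsConvexBody K)
    (μ : Measure (EuclideanSpace ℝ (Fin d))) (hμ : IsLocallyFiniteMeasure μ)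
    (htile : ∀ᵐ x ∂(volume : Measure (EuclideanSpace ℝ (Fin d))),
      (∫⁻ t, Set.indicator K (fun _ => (1 : ℝ≥0∞)) (x - t) ∂μ) =
        Set.indicator Kᶜ (fun _ => (1 : ℝ≥0∞)) x)
    (x ξ : EuclideanSpace ℝ (Fin d)) (hreg : IsRegularPointWithNormal K x ξ) :
    1 ≤ μ ((fun y => x - y) '' SuppSet K (-ξ)) := by
  have hKc : IsClosed K := hbody.1.isClosed
  simp_rw [lintegral_indicator_sub_eq_measure hKc] at htile
  have hnull := measure_interior_sub_interior_eq_zero_s15 (K := K) (μ := μ) <| by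
    filter_upwards [htile] with y hy hyK
    simp [hy, hyK]
  have hone : 1 ≤ μ ((fun y => x - y) '' K) := by
    refine one_le_measure_sub_of_frequently hbody.1 μ fun δ hδ => ?_
    have hx : x ∈ closure Kᶜ := frontier_subset_closure (frontier_compl K ▸ hreg.1)
    obtain ⟨w, hwK, hwx⟩ := Metric.mem_closure_iff.1 hx δ hδ
    obtain ⟨y, ⟨hyK, hyx⟩, hy⟩ := exists_mem_of_ae_of_isOpen htile
      (hKc.isOpen_compl.inter (Metric.isOpen_ball (x := x) (ε := δ)))
      ⟨w, hwK, Metric.mem_ball'.2 hwx⟩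
    exact ⟨y, hyx, by rw [hy, Set.indicator_of_mem hyK]⟩
  refine hone.trans ((measure_mono ?_).trans
    ((measure_union_le ((fun y => x - y) '' SuppSet K (-ξ)) _).trans_eq
      (by rw [hnull, add_zero])))
  rintro _ ⟨k, hk, rfl⟩
  by_cases hxk : x - k ∈ {p | ∃ a ∈ interior K, ∃ b ∈ interior K, p = a - b}
  · exact Or.inr hxk
  · exact Or.inl ⟨k, mem_suppSet_of_sub_notMem hbody hreg hk hxk, rfl⟩
end
end

section
/- Let K be a convex body in ℝ^d, and let x, x' be two regular boundary points of K with exterior normal unit vectors ξ and ξ' respectively. If ξ ≠ ξ', then the sets −S(K, −ξ) + x and −S(K, −ξ') + x' are disjoint. -/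
open MeasureTheory Set Filter
open scoped RealInnerProductSpace

noncomputable section

/-- For two regular boundary points `x, x'` of a convex body `K` with distinct exterior
unit normals `ξ ≠ ξ'`, the sets `-S(K, -ξ) + x` and `-S(K, -ξ') + x'` are disjoint. -/
theorem support_sets_disjoint
    (d : ℕ) (K : Set (EuclideanSpace ℝ (Fin d)))
    (hbody : IsConvexBody K)
    (x ξ x' ξ' : EuclideanSpace ℝ (Fin d))
    (hreg : IsRegularPointWithNormal K x ξ) (hreg' : IsRegularPointWithNormal K x' ξ')
    (hne : ξ ≠ ξ') :
    Disjoint ((fun y => x - y) '' SuppSet K (-ξ)) ((fun y => x' - y) '' SuppSet K (-ξ')) := by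
  rw [Set.disjoint_left]
  rintro _ ⟨y, ⟨-, hy⟩, rfl⟩ ⟨y', ⟨hy'K, -⟩, hxy⟩
  obtain ⟨-, hξ, hx, -⟩ := hreg
  obtain ⟨-, -, -, huniq⟩ := hreg'
  refine hne (huniq ξ hξ fun z hz => (hx z hz).trans ?_)
  have hmin := hy y' hy'K
  have hinner : ⟪x' - y', ξ⟫ = ⟪x - y, ξ⟫ := congrArg (fun v => ⟪v, ξ⟫) hxy
  simp only [inner_neg_right, inner_sub_left] at hmin hinner
  linarith
end
end

section
/- Let A ⊂ ℝ^d be a convex polytope with nonempty interior, and let F be a facet of A, i.e. a (d−1)-dimensional face of A. Then the relative interior of the difference set F − F is contained in the interior of the difference set A − A: relint(F − F) ⊂ int(A − A). -/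
open MeasureTheory Set Filter
open scoped RealInnerProductSpace Pointwise

noncomputable section

/-- `F` is a face of `A`: a support set of `A`, i.e. the set of points of `A` maximizing a
nonzero linear functional over `A`. -/
def IsFaceOf {d : ℕ} (A F : Set (EuclideanSpace ℝ (Fin d))) : Prop :=
  ∃ ξ : EuclideanSpace ℝ (Fin d), ξ ≠ 0 ∧
    F = {y ∈ A | ∀ z ∈ A, ⟪z, ξ⟫ ≤ ⟪y, ξ⟫}

/-- A facet of `A ⊆ ℝ^d`: a `(d-1)`-dimensional face. -/
def IsFacetOf {d : ℕ} (A F : Set (EuclideanSpace ℝ (Fin d))) : Prop :=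
  IsFaceOf A F ∧ Module.finrank ℝ (affineSpan ℝ F).direction = d - 1

/-- If `0` and `x` lie in `s` and `x` is in the relative interior of `s`, the segment from `0` to `x`
extends slightly beyond `x` inside `s`. -/
lemma exists_one_lt_smul_mem_of_mem_intrinsicInterior {E : Type*} [NormedAddCommGroup E]
    [NormedSpace ℝ E] {s : Set E} {x : E} (h0 : (0 : E) ∈ s) (hx : x ∈ intrinsicInterior ℝ s) :
    ∃ t : ℝ, 1 < t ∧ t • x ∈ s := by
  obtain ⟨y, hy, rfl⟩ := mem_intrinsicInterior.1 hx
  have hspan (t : ℝ) : t • (y : E) ∈ affineSpan ℝ s := by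
    simpa [AffineMap.lineMap_apply] using
      AffineMap.lineMap_mem t (subset_affineSpan ℝ s h0) y.2
  let g : ℝ → affineSpan ℝ s := fun t => ⟨t • (y : E), hspan t⟩
  have hg : Continuous g := by fun_prop
  have hg1 : g 1 = y := by simp [g]
  have hev : ∀ᶠ t in nhds (1 : ℝ), t • (y : E) ∈ s := by
    filter_upwards [hg.continuousAt.preimage_mem_nhds
      (by rw [hg1]; exact mem_interior_iff_mem_nhds.1 hy)] with t ht using ht
  obtain ⟨t, ht, hts⟩ := ((hev.filter_mono nhdsWithin_le_nhds).and
    (self_mem_nhdsWithin (a := (1 : ℝ)) (s := Ioi 1))).exists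
  exact ⟨t, hts, ht⟩

/-- The origin is interior to the difference set of a set with nonempty interior. -/
lemma zero_mem_interior_sub_self {E : Type*} [NormedAddCommGroup E] {s : Set E}
    (hs : (interior s).Nonempty) : (0 : E) ∈ interior (s - s) := by
  obtain ⟨a, ha⟩ := hs
  exact subset_interior_sub_left (sub_self a ▸ Set.sub_mem_sub ha (interior_subset ha))

/-- For a facet `F` of a convex polytope `A` with nonempty interior, the relative interior of
`F - F` is contained in the interior of `A - A`. -/
theorem relint_sub_facet_subset_interior
    (d : ℕ) (A F : Set (EuclideanSpace ℝ (Fin d)))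
    (hpoly : IsConvexPolytope A) (hint : (interior A).Nonempty)
    (hF : IsFacetOf A F) :
    intrinsicInterior ℝ (F - F) ⊆ interior (A - A) := by
  intro x hx
  obtain ⟨⟨ξ, -, rfl⟩, -⟩ := hF
  obtain ⟨S, -, rfl⟩ := hpoly
  have hconv := (convex_convexHull ℝ S).sub (convex_convexHull ℝ S)
  obtain ⟨p, hp, -, -, -⟩ := Set.mem_sub.1 (intrinsicInterior_subset hx)
  obtain ⟨t, ht, htx⟩ := exists_one_lt_smul_mem_of_mem_intrinsicInterior
    (sub_self p ▸ Set.sub_mem_sub hp hp) hx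
  have hmem := hconv.combo_interior_self_mem_interior (zero_mem_interior_sub_self hint)
    (Set.sub_subset_sub (Set.sep_subset _ _) (Set.sep_subset _ _) htx)
    (sub_pos.2 (inv_lt_one_of_one_lt₀ ht)) (by positivity : (0 : ℝ) ≤ t⁻¹) (by ring)
  simpa [smul_smul, (zero_lt_one.trans ht).ne'] using hmem
end
end

section
/- Let A ⊂ ℝ^d be a convex polytope with nonempty interior, let F be a facet of A with exterior normal unit vector ξ, and let {z : ⟨z, ξ⟩ ≤ c} be the support halfspace of A at F (so F = A ∩ {z : ⟨z, ξ⟩ = c} and A ⊂ {z : ⟨z, ξ⟩ ≤ c}). For δ > 0 let P_δ = A ∩ {z : c − δ ≤ ⟨z, ξ⟩ ≤ c} and let Q_δ be the convex hull of F ∪ (F − δξ). Then m(P_δ △ Q_δ)/δ → 0 as δ → 0⁺, where m is Lebesgue measure and △ denotes symmetric difference. -/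
open MeasureTheory Set Filter
open scoped RealInnerProductSpace Pointwise ENNReal

noncomputable section

section Slab

variable {E : Type*} [NormedAddCommGroup E] [InnerProductSpace ℝ E]

/-- The affine map rescaling by `δ` the signed distance to the hyperplane `⟪x, ξ⟫ = c`. -/
def normalStretch (ξ : E) (c δ : ℝ) (x : E) : E := x + ((δ - 1) * (⟪x, ξ⟫ - c)) • ξ

/-- The right prism of height `δ` below a set `F` of the hyperplane `⟪x, ξ⟫ = c`. -/
def rightPrism (F : Set E) (ξ : E) (c δ : ℝ) : Set E :=
  {x | c - δ ≤ ⟪x, ξ⟫ ∧ ⟪x, ξ⟫ ≤ c ∧ x - (⟪x, ξ⟫ - c) • ξ ∈ F}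

lemma inner_add_smul_self_of_norm_one {ξ : E} (hξ : ‖ξ‖ = 1) (x : E) (t : ℝ) :
    ⟪x + t • ξ, ξ⟫ = ⟪x, ξ⟫ + t := by
  simp [inner_add_left, real_inner_smul_left, hξ]

lemma inner_normalStretch {ξ : E} (hξ : ‖ξ‖ = 1) (c δ : ℝ) (x : E) :
    ⟪normalStretch ξ c δ x, ξ⟫ - c = δ * (⟪x, ξ⟫ - c) := by
  rw [normalStretch, inner_add_smul_self_of_norm_one hξ]; ring

lemma continuous_normalStretch (ξ : E) (c δ : ℝ) : Continuous (normalStretch ξ c δ) := by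
  unfold normalStretch; fun_prop

lemma convex_rightPrism {F : Set E} (hF : Convex ℝ F) (ξ : E) (c δ : ℝ) :
    Convex ℝ (rightPrism F ξ c δ) := by
  rintro x ⟨hx1, hx2, hx3⟩ y ⟨hy1, hy2, hy3⟩ a b ha hb hab
  have hin : ⟪a • x + b • y, ξ⟫ = a * ⟪x, ξ⟫ + b * ⟪y, ξ⟫ := by
    simp [inner_add_left, real_inner_smul_left]
  obtain rfl : b = 1 - a := by linarith
  refine ⟨?_, ?_, ?_⟩
  · rw [hin]; nlinarith
  · rw [hin]; nlinarith
  · convert hF hx3 hy3 ha hb hab using 1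
    rw [hin]; module

lemma isClosed_rightPrism {F : Set E} (hF : IsClosed F) (ξ : E) (c δ : ℝ) :
    IsClosed (rightPrism F ξ c δ) := by
  have hin : Continuous fun x : E => ⟪x, ξ⟫ := by fun_prop
  exact (isClosed_le continuous_const hin).inter
    ((isClosed_le hin continuous_const).inter (hF.preimage (by fun_prop)))

lemma convexHull_union_sub_smul_eq_rightPrism {F : Set E} (hF : Convex ℝ F) {ξ : E}
    (hξ : ‖ξ‖ = 1) {c δ : ℝ} (hFc : ∀ x ∈ F, ⟪x, ξ⟫ = c) (hδ : 0 < δ) :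
    convexHull ℝ (F ∪ ((fun y => y - δ • ξ) '' F)) = rightPrism F ξ c δ := by
  apply Subset.antisymm
  · refine convexHull_min ?_ (convex_rightPrism hF ξ c δ)
    rintro x (hx | ⟨y, hy, rfl⟩)
    · have := hFc x hx
      refine ⟨by linarith, by linarith, ?_⟩
      simpa [this] using hx
    · have h : ⟪y - δ • ξ, ξ⟫ = c - δ := by
        rw [sub_eq_add_neg, ← neg_smul, inner_add_smul_self_of_norm_one hξ, hFc y hy]; ring
      refine ⟨h.ge, by linarith, ?_⟩
      change y - δ • ξ - (⟪y - δ • ξ, ξ⟫ - c) • ξ ∈ F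
      rw [h]
      convert hy using 1
      module
  · rintro x ⟨h1, h2, h3⟩
    have hconv := convex_convexHull ℝ (F ∪ ((fun y => y - δ • ξ) '' F))
    have hk0 : 0 ≤ (c - ⟪x, ξ⟫) / δ := div_nonneg (by linarith) hδ.le
    have hk1 : (c - ⟪x, ξ⟫) / δ ≤ 1 := by rw [div_le_one hδ]; linarith
    convert hconv (subset_convexHull ℝ _ (Or.inl h3))
      (subset_convexHull ℝ _ (Or.inr ⟨_, h3, rfl⟩)) (sub_nonneg.2 hk1) hk0 (by ring) using 1
    match_scalars
    · ring
    · field_simp; ring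

lemma normalStretch_mem_slab_iff {A : Set E} {ξ : E} (hξ : ‖ξ‖ = 1) {c δ : ℝ} (hδ : 0 < δ)
    (x : E) :
    normalStretch ξ c δ x ∈ A ∩ {z : E | c - δ ≤ ⟪z, ξ⟫ ∧ ⟪z, ξ⟫ ≤ c} ↔
      normalStretch ξ c δ x ∈ A ∧ c - 1 ≤ ⟪x, ξ⟫ ∧ ⟪x, ξ⟫ ≤ c := by
  have h := inner_normalStretch hξ c δ x
  refine and_congr_right fun _ => and_congr ?_ ?_
  · constructor <;> intro _ <;> nlinarith
  · constructor <;> intro _ <;> nlinarith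

lemma normalStretch_mem_rightPrism_iff {F : Set E} {ξ : E} (hξ : ‖ξ‖ = 1) {c δ : ℝ} (hδ : 0 < δ)
    (x : E) :
    normalStretch ξ c δ x ∈ rightPrism F ξ c δ ↔ x ∈ rightPrism F ξ c 1 := by
  have h := inner_normalStretch hξ c δ x
  refine and_congr ?_ (and_congr ?_ ?_)
  · constructor <;> intro _ <;> nlinarith
  · constructor <;> intro _ <;> nlinarith
  · rw [h, normalStretch]
    have : x + ((δ - 1) * (⟪x, ξ⟫ - c)) • ξ - (δ * (⟪x, ξ⟫ - c)) • ξ = x - (⟪x, ξ⟫ - c) • ξ := by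
      module
    rw [this]

lemma volume_preimage_normalStretch [FiniteDimensional ℝ E] [MeasurableSpace E] [BorelSpace E]
    {ξ : E} (hξ : ‖ξ‖ = 1) (c : ℝ) {δ : ℝ} (hδ : 0 < δ) (s : Set E) :
    volume (normalStretch ξ c δ ⁻¹' s) = ENNReal.ofReal δ⁻¹ * volume s := by
  let L := LinearMap.transvection (innerₗ E ξ) ((δ - 1) • ξ)
  have hdet : LinearMap.det L = δ := by
    rw [LinearMap.transvection.det]
    simp [hξ]
  have hpre : normalStretch ξ c δ ⁻¹' s = L ⁻¹' ((fun x => x + (-((δ - 1) * c)) • ξ) ⁻¹' s) := by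
    ext x
    have : normalStretch ξ c δ x = L x + (-((δ - 1) * c)) • ξ := by
      simp only [L, normalStretch, LinearMap.transvection.apply, innerₗ_apply_apply,
        real_inner_comm x ξ]
      module
    simp [this]
  rw [hpre, Measure.addHaar_preimage_linearMap _ (by rw [hdet]; exact hδ.ne'), hdet,
    measure_preimage_add_right, abs_of_pos (inv_pos.2 hδ)]

lemma exists_mem_inner_lt_of_interior_nonempty {A : Set E} {ξ : E} (hξ : ‖ξ‖ = 1) {c : ℝ}
    (hint : (interior A).Nonempty) (hA : ∀ x ∈ A, ⟪x, ξ⟫ ≤ c) : ∃ p ∈ A, ⟪p, ξ⟫ < c := by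
  obtain ⟨p, hp⟩ := hint
  have hcont : Tendsto (fun t : ℝ => p + t • ξ) (nhdsWithin 0 (Ioi 0)) (nhds p) := by
    have : Continuous (fun t : ℝ => p + t • ξ) := by fun_prop
    simpa using (this.tendsto 0).mono_left nhdsWithin_le_nhds
  obtain ⟨t, ht, ht0 : 0 < t⟩ := ((hcont.eventually (mem_interior_iff_mem_nhds.1 hp)).and
    self_mem_nhdsWithin).exists
  have := hA _ ht
  rw [inner_add_smul_self_of_norm_one hξ] at this
  exact ⟨p, interior_subset hp, by linarith⟩

/-- Inside the unit prism over the support set `F`, stretched points eventually enter `A`. -/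
lemma eventually_normalStretch_mem {A : Set E} (hA : Convex ℝ A) {ξ : E} (hξ : ‖ξ‖ = 1) {c : ℝ}
    {p : E} (hpA : p ∈ A) (hp : ⟪p, ξ⟫ < c) {x : E}
    (hx : x ∈ interior (rightPrism (A ∩ {z : E | ⟪z, ξ⟫ = c}) ξ c 1)) :
    ∀ᶠ δ in nhdsWithin (0 : ℝ) (Ioi 0), normalStretch ξ c δ x ∈ A := by
  obtain ⟨-, hxc, hyA, -⟩ := interior_subset hx
  set h := ⟪x, ξ⟫ - c with hh
  set k := ⟪p, ξ⟫ - c with hk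
  set v := (x - h • ξ) - (p - k • ξ) with hv
  have hvξ : ⟪v, ξ⟫ = 0 := by
    simp [hv, hh, hk, inner_sub_left, real_inner_smul_left, hξ]
  have hcont : Tendsto (fun t : ℝ => x + t • v) (nhdsWithin 0 (Ioi 0)) (nhds x) := by
    have : Continuous (fun t : ℝ => x + t • v) := by fun_prop
    simpa using (this.tendsto 0).mono_left nhdsWithin_le_nhds
  obtain ⟨t, ⟨-, -, htA, -⟩, ht0 : 0 < t⟩ :=
    ((hcont.eventually (mem_interior_iff_mem_nhds.1 hx)).and self_mem_nhdsWithin).exists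
  have hin : ⟪x + t • v, ξ⟫ - c = h := by
    simp [inner_add_left, real_inner_smul_left, hvξ, hh]
  rw [hin] at htA
  have ht1 : 0 < 1 + t := by linarith
  set κ := t * k / (1 + t) with hκ
  have hκ0 : κ < 0 := div_neg_of_neg_of_pos (mul_neg_of_pos_of_neg ht0 (by linarith)) ht1
  have hlow : x - h • ξ + κ • ξ ∈ A := by
    convert hA htA hpA (a := 1 / (1 + t)) (b := t / (1 + t)) (by positivity) (by positivity)
      (by field_simp) using 1
    rw [hv, hκ]
    match_scalars <;> field_simp <;> ring
  have hlim : Tendsto (fun δ : ℝ => δ * h / κ) (nhdsWithin 0 (Ioi 0)) (nhds 0) := by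
    have : Continuous (fun δ : ℝ => δ * h / κ) := by fun_prop
    simpa using (this.tendsto 0).mono_left nhdsWithin_le_nhds
  filter_upwards [hlim.eventually (gt_mem_nhds one_pos), self_mem_nhdsWithin] with δ hδ1 hδ0
  have hδ0' : 0 ≤ δ * h / κ :=
    div_nonneg_of_nonpos (mul_nonpos_of_nonneg_of_nonpos (le_of_lt hδ0) (by linarith)) hκ0.le
  convert hA hyA hlow (sub_nonneg.2 hδ1.le) hδ0' (by ring) using 1
  rw [normalStretch, ← hh]
  have hκ' := hκ0.ne
  clear_value κ
  match_scalars
  · ring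
  · field_simp; ring

lemma eventually_normalStretch_notMem {A : Set E} (hA : IsClosed A) {ξ : E} {c : ℝ} {x : E}
    (hx : x - (⟪x, ξ⟫ - c) • ξ ∉ A) :
    ∀ᶠ δ in nhdsWithin (0 : ℝ) (Ioi 0), normalStretch ξ c δ x ∉ A := by
  have hlim : Tendsto (fun δ : ℝ => normalStretch ξ c δ x) (nhdsWithin 0 (Ioi 0))
      (nhds (x - (⟪x, ξ⟫ - c) • ξ)) := by
    have : Continuous (fun δ : ℝ => normalStretch ξ c δ x) := by unfold normalStretch; fun_prop
    convert (this.tendsto 0).mono_left nhdsWithin_le_nhds using 2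
    rw [normalStretch]; module
  exact hlim.eventually (hA.isOpen_compl.mem_nhds hx)

/-- The slab of a compact convex body at a support hyperplane agrees with the prism over the
support set up to a set of measure `o(δ)`. -/
theorem tendsto_volume_symmDiff_slab_prism [FiniteDimensional ℝ E] [MeasurableSpace E]
    [BorelSpace E] {A : Set E} (hconv : Convex ℝ A) (hcomp : IsCompact A)
    (hint : (interior A).Nonempty) {ξ : E} (hξ : ‖ξ‖ = 1) {c : ℝ} (hhalf : ∀ x ∈ A, ⟪x, ξ⟫ ≤ c) :
    Tendsto
      (fun δ : ℝ =>
        (volume (symmDiff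
          (A ∩ {z : E | c - δ ≤ ⟪z, ξ⟫ ∧ ⟪z, ξ⟫ ≤ c})
          (convexHull ℝ ((A ∩ {z : E | ⟪z, ξ⟫ = c}) ∪
            ((fun y => y - δ • ξ) '' (A ∩ {z : E | ⟪z, ξ⟫ = c})))))).toReal / δ)
      (nhdsWithin 0 (Ioi 0)) (nhds 0) := by
  set F := A ∩ {z : E | ⟪z, ξ⟫ = c} with hF
  have hin : Continuous fun x : E => ⟪x, ξ⟫ := by fun_prop
  have hFclosed : IsClosed F := hcomp.isClosed.inter (isClosed_eq hin continuous_const)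
  have hFconv : Convex ℝ F := by
    refine hconv.inter fun x hx y hy a b _ _ hab => ?_
    simp only [mem_ofPred_eq] at hx hy ⊢
    rw [inner_add_left, real_inner_smul_left, real_inner_smul_left, hx, hy, ← add_mul, hab, one_mul]
  let Q := rightPrism F ξ c 1
  let P : ℝ → Set E := fun δ => {x | normalStretch ξ c δ x ∈ A ∧ c - 1 ≤ ⟪x, ξ⟫ ∧ ⟪x, ξ⟫ ≤ c}
  have hQclosed : IsClosed Q := isClosed_rightPrism hFclosed ξ c 1
  have hPclosed (δ : ℝ) : IsClosed (P δ) :=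
    (hcomp.isClosed.preimage (continuous_normalStretch ξ c δ)).inter
      ((isClosed_le continuous_const hin).inter (isClosed_le hin continuous_const))
  obtain ⟨R, hR⟩ := hcomp.isBounded.exists_norm_le
  have hnorm {x y : E} {t : ℝ} (hyA : y ∈ A) (hxy : y = x + t • ξ) (ht : |t| ≤ 1) :
      x ∈ Metric.closedBall 0 (R + 1) := by
    rw [mem_closedBall_zero_iff]
    calc ‖x‖ = ‖y - t • ξ‖ := by rw [hxy, add_sub_cancel_right]
      _ ≤ ‖y‖ + ‖t • ξ‖ := norm_sub_le _ _
      _ ≤ R + 1 := add_le_add (hR _ hyA) (by rwa [norm_smul, hξ, mul_one])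
  obtain ⟨p, hpA, hp⟩ := exists_mem_inner_lt_of_interior_nonempty hξ hint hhalf
  have key : Tendsto (fun δ => volume (symmDiff (P δ) Q)) (nhdsWithin 0 (Ioi 0))
      (nhds (volume (∅ : Set E))) := by
    refine tendsto_measure_of_ae_tendsto_indicator _ MeasurableSet.empty
      (fun δ => (hPclosed δ).measurableSet.symmDiff hQclosed.measurableSet)
      (B := Metric.closedBall 0 (R + 1)) measurableSet_closedBall
      (isCompact_closedBall _ _).measure_lt_top.ne ?_ ?_
    · filter_upwards [Ioc_mem_nhdsGT one_pos] with δ hδ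
      rintro x (⟨⟨hxA, h1, h2⟩, -⟩ | ⟨⟨h1, h2, hxF⟩, -⟩)
      · refine hnorm hxA rfl ?_
        rw [abs_le]
        constructor <;> nlinarith [hδ.1, hδ.2]
      · refine hnorm hxF.1 (t := -(⟪x, ξ⟫ - c)) (by module) ?_
        rw [abs_le]
        constructor <;> linarith
    · have hnull : volume (frontier Q) = 0 := (convex_rightPrism hFconv ξ c 1).addHaar_frontier _
      filter_upwards [measure_eq_zero_iff_ae_notMem.1 hnull] with x hx
      by_cases hxQ : x ∈ Q
      · have hxint : x ∈ interior Q := by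
          by_contra hn
          exact hx ⟨subset_closure hxQ, hn⟩
        filter_upwards [eventually_normalStretch_mem hconv hξ hpA hp hxint] with δ hδ
        have : x ∈ P δ := ⟨hδ, hxQ.1, hxQ.2.1⟩
        simp [mem_symmDiff, this, hxQ]
      · suffices ∀ᶠ δ in nhdsWithin (0 : ℝ) (Ioi 0), x ∉ P δ by
          filter_upwards [this] with δ hδ
          simp [mem_symmDiff, hδ, hxQ]
        by_cases hx1 : c - 1 ≤ ⟪x, ξ⟫ ∧ ⟪x, ξ⟫ ≤ c
        · have hxA : x - (⟪x, ξ⟫ - c) • ξ ∉ A := by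
            intro hxA
            refine hxQ ⟨hx1.1, hx1.2, hxA, ?_⟩
            simp [inner_sub_left, real_inner_smul_left, hξ]
          filter_upwards [eventually_normalStretch_notMem hcomp.isClosed hxA] with δ hδ hxP
          exact hδ hxP.1
        · exact Eventually.of_forall fun δ hxP => hx1 hxP.2
  rw [measure_empty] at key
  have key' := (ENNReal.tendsto_toReal ENNReal.zero_ne_top).comp key
  rw [ENNReal.toReal_zero] at key'
  refine key'.congr' ?_
  filter_upwards [self_mem_nhdsWithin] with δ (hδ : 0 < δ)
  rw [convexHull_union_sub_smul_eq_rightPrism hFconv hξ (fun x hx => hx.2) hδ]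
  have hset : symmDiff (P δ) Q = normalStretch ξ c δ ⁻¹'
      (symmDiff (A ∩ {z : E | c - δ ≤ ⟪z, ξ⟫ ∧ ⟪z, ξ⟫ ≤ c}) (rightPrism F ξ c δ)) := by
    ext x
    rw [mem_preimage, mem_symmDiff, mem_symmDiff, normalStretch_mem_slab_iff hξ hδ,
      normalStretch_mem_rightPrism_iff hξ hδ]
    rfl
  simp only [Function.comp_apply]
  rw [hset, volume_preimage_normalStretch hξ c hδ, ENNReal.toReal_mul,
    ENNReal.toReal_ofReal (inv_pos.2 hδ).le, div_eq_inv_mul]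

end Slab

/-- For a facet `F` of a convex polytope `A` with exterior unit normal `ξ` and support
halfspace `{z : ⟨z, ξ⟩ ≤ c}`, the slab piece `P_δ = A ∩ {z : c - δ ≤ ⟨z, ξ⟩ ≤ c}` and the
prism `Q_δ = conv(F ∪ (F - δξ))` satisfy `m(P_δ ∆ Q_δ)/δ → 0` as `δ → 0⁺`. -/
theorem slab_approx_prism
    (d : ℕ) (A F : Set (EuclideanSpace ℝ (Fin d)))
    (ξ : EuclideanSpace ℝ (Fin d)) (c : ℝ)
    (hpoly : IsConvexPolytope A) (hint : (interior A).Nonempty)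
    (hξ : ‖ξ‖ = 1)
    (hhalf : A ⊆ {z : EuclideanSpace ℝ (Fin d) | ⟪z, ξ⟫ ≤ c})
    (hF : F = A ∩ {z : EuclideanSpace ℝ (Fin d) | ⟪z, ξ⟫ = c})
    (hfacet : Module.finrank ℝ (affineSpan ℝ F).direction = d - 1) :
    Tendsto
      (fun δ : ℝ =>
        (volume (symmDiff
          (A ∩ {z : EuclideanSpace ℝ (Fin d) | c - δ ≤ ⟪z, ξ⟫ ∧ ⟪z, ξ⟫ ≤ c})
          (convexHull ℝ (F ∪ ((fun y => y - δ • ξ) '' F))))).toReal / δ)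
      (nhdsWithin 0 (Set.Ioi 0)) (nhds 0) := by
  obtain ⟨S, hS, rfl⟩ := hpoly
  subst hF
  exact tendsto_volume_symmDiff_slab_prism (convex_convexHull ℝ S) (hS.isCompact_convexHull ℝ) hint hξ
    hhalf
end
end

section
/- Let A and B be convex polytopes in ℝ^d with nonempty interiors, such that int(A) ∩ int(B) = ∅ and A and B share a common facet F (F is a facet of both A and B). Let μ be a positive locally finite Borel measure on ℝ^d such that (1_A ∗ μ)(x) ≥ 1 for Lebesgue-a.e. x ∈ A and (1_A ∗ μ)(x) = 0 for Lebesgue-a.e. x ∈ B. Let μ' be the restriction of μ to relint(F − F), and let σ_F denote the (d−1)-dimensional Hausdorff measure restricted to F. Then (σ_F ∗ μ')(E) ≥ σ_F(E) for every Borel set E ⊂ ℝ^d. -/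
open MeasureTheory Set Filter
open scoped RealInnerProductSpace Pointwise ENNReal

noncomputable section

section ConvexGeometry

variable {X : Type*} [NormedAddCommGroup X] [InnerProductSpace ℝ X]

/-- A linear functional that is bounded above on `A` by its value at `x` is strictly smaller at
interior points of `A`. -/
lemma inner_lt_of_mem_interior {A : Set X} {ξ x a : X} (hξ : ξ ≠ 0)
    (hmax : ∀ z ∈ A, ⟪z, ξ⟫ ≤ ⟪x, ξ⟫) (ha : a ∈ interior A) : ⟪a, ξ⟫ < ⟪x, ξ⟫ := by
  have hcont : Tendsto (fun s : ℝ => a + s • ξ) (nhdsWithin 0 (Ioi 0)) (nhds a) := by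
    have : Continuous (fun s : ℝ => a + s • ξ) := by fun_prop
    simpa using (this.tendsto 0).mono_left nhdsWithin_le_nhds
  obtain ⟨s, hsA, hs⟩ := ((hcont.eventually (mem_interior_iff_mem_nhds.1 ha)).and
    self_mem_nhdsWithin).exists
  have h := hmax _ hsA
  rw [inner_add_left, real_inner_smul_left] at h
  have : 0 < s * ⟪ξ, ξ⟫ := mul_pos hs (real_inner_self_pos.2 hξ)
  linarith

/-- If `A` contains a neighbourhood of `x` relative to a hyperplane, together with an interior
point strictly below the hyperplane, then its interior contains a half-neighbourhood of `x`. -/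
lemma Convex.eventually_mem_interior_of_inner_lt {A : Set X} (hA : Convex ℝ A) {ξ x a : X}
    (ha : a ∈ interior A) (hax : ⟪a, ξ⟫ < ⟪x, ξ⟫)
    (hx : ∀ᶠ y in nhds x, ⟪y, ξ⟫ = ⟪x, ξ⟫ → y ∈ A) :
    ∀ᶠ z in nhds x, ⟪z, ξ⟫ < ⟪x, ξ⟫ → z ∈ interior A := by
  set θ : X → ℝ := fun z => (⟪x, ξ⟫ - ⟪z, ξ⟫) / (⟪x, ξ⟫ - ⟪a, ξ⟫) with hθ
  have hpos : 0 < ⟪x, ξ⟫ - ⟪a, ξ⟫ := sub_pos.2 hax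
  have hθc : Continuous θ := by fun_prop
  have hθx : θ x = 0 := by simp [hθ]
  set g : X → X := fun z => (1 - θ z)⁻¹ • (z - θ z • a) with hg
  have hgc : Tendsto g (nhds x) (nhds x) := by
    have : ContinuousAt g x := by
      refine ContinuousAt.smul (ContinuousAt.inv₀ (by fun_prop) (by simp [hθx])) (by fun_prop)
    simpa [ContinuousAt, hg, hθx] using this
  have hlt : ∀ᶠ z in nhds x, θ z < 1 :=
    (hθc.tendsto x).eventually_lt_const (by simp [hθx])
  filter_upwards [hgc.eventually hx, hlt] with z hz hz1 hzx
  have h1 : 0 < 1 - θ z := sub_pos.2 hz1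
  have h0 : 0 < θ z := div_pos (sub_pos.2 hzx) hpos
  have hgA : g z ∈ A := by
    apply hz
    have hmul : θ z * (⟪x, ξ⟫ - ⟪a, ξ⟫) = ⟪x, ξ⟫ - ⟪z, ξ⟫ := div_mul_cancel₀ _ hpos.ne'
    simp only [hg, real_inner_smul_left, inner_sub_left]
    rw [inv_mul_eq_iff_eq_mul₀ h1.ne']
    linarith
  have hcombo := hA.combo_self_interior_mem_interior hgA ha h1.le h0 (by ring)
  have : (1 - θ z) • g z + θ z • a = z := by
    simp only [hg, smul_smul, mul_inv_cancel₀ h1.ne', one_smul, sub_add_cancel]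
  rwa [this] at hcombo

/-- If `A` and `B` contain opposite half-neighbourhoods of `x` and `a ∈ A` lies strictly below the
separating hyperplane, then translating `A` by `x - a` makes its interior meet that of `B`. -/
lemma sub_mem_interior_sub_interior {A B : Set X} (hA : Convex ℝ A) {ξ x a : X} (hξ : ξ ≠ 0)
    (hxA : ∀ᶠ z in nhds x, ⟪z, ξ⟫ < ⟪x, ξ⟫ → z ∈ interior A)
    (hxB : ∀ᶠ z in nhds x, ⟪x, ξ⟫ < ⟪z, ξ⟫ → z ∈ interior B)
    (ha : a ∈ A) (hax : ⟪a, ξ⟫ < ⟪x, ξ⟫) : x - a ∈ interior B - interior A := by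
  obtain ⟨b, hbA, hab⟩ : ∃ b ∈ interior A, ⟪a, ξ⟫ < ⟪b, ξ⟫ := by
    have hcont : Tendsto (fun s : ℝ => x - s • ξ) (nhdsWithin 0 (Ioi 0)) (nhds x) := by
      have : Continuous (fun s : ℝ => x - s • ξ) := by fun_prop
      simpa using (this.tendsto 0).mono_left nhdsWithin_le_nhds
    have hval : ∀ᶠ z in nhds x, ⟪a, ξ⟫ < ⟪z, ξ⟫ :=
      (Continuous.tendsto (by fun_prop : Continuous fun z : X => ⟪z, ξ⟫) x).eventually_const_lt hax
    obtain ⟨s, ⟨h1, h2⟩, hs⟩ :=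
      ((hcont.eventually (hxA.and hval)).and self_mem_nhdsWithin).exists
    refine ⟨x - s • ξ, h1 ?_, h2⟩
    rw [inner_sub_left, real_inner_smul_left]
    have : 0 < s * ⟪ξ, ξ⟫ := mul_pos hs (real_inner_self_pos.2 hξ)
    linarith
  have hcont : Tendsto (fun s : ℝ => x + s • (b - a)) (nhdsWithin 0 (Ioi 0)) (nhds x) := by
    have : Continuous (fun s : ℝ => x + s • (b - a)) := by fun_prop
    simpa using (this.tendsto 0).mono_left nhdsWithin_le_nhds
  obtain ⟨s, ⟨hB, hs1⟩, hs⟩ := ((hcont.eventually hxB).and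
    (Ioc_mem_nhdsGT (zero_lt_one' ℝ))).and self_mem_nhdsWithin |>.exists
  refine ⟨x + s • (b - a), hB ?_, a + s • (b - a), ?_, by simp⟩
  · rw [inner_add_left, real_inner_smul_left, inner_sub_left]
    have := mul_pos hs (sub_pos.2 hab)
    linarith
  · have := hA.combo_self_interior_mem_interior ha hbA (sub_nonneg.2 hs1.2) hs1.1 (by ring)
    convert this using 1
    module

end ConvexGeometry

section Measure

variable {X : Type*} [NormedAddCommGroup X] [NormedSpace ℝ X] [FiniteDimensional ℝ X]
  [MeasurableSpace X] [BorelSpace X]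

/-- If `μ (x - A)` vanishes for almost every `x ∈ B`, then `μ` vanishes on
`interior B - interior A`. -/
lemma measure_interior_sub_interior_eq_zero_s19 {ν μ : Measure X} [ν.IsOpenPosMeasure] {A B : Set X}
    (h : ∀ᵐ x ∂ν.restrict B, μ {t | x - t ∈ A} = 0) :
    μ (interior B - interior A) = 0 := by
  refine measure_null_of_locally_null _ fun t ht => ?_
  obtain ⟨b, hb, a, ha, rfl⟩ := ht
  have hopen : IsOpen {x | x ∈ interior B ∧ x - (b - a) ∈ interior A} :=
    isOpen_interior.inter (isOpen_interior.preimage (by fun_prop))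
  have hpos : ν {x | x ∈ interior B ∧ x - (b - a) ∈ interior A} ≠ 0 :=
    hopen.measure_ne_zero ν ⟨b, hb, by simpa using ha⟩
  have h' := ae_restrict_of_ae_restrict_of_subset
    (s := {x | x ∈ interior B ∧ x - (b - a) ∈ interior A})
    (fun x hx => interior_subset hx.1) h
  rw [ae_restrict_iff' hopen.measurableSet] at h'
  obtain ⟨x, hx, hx0⟩ := (frequently_ae_mem_iff.2 hpos).and_eventually h' |>.exists
  refine ⟨{t | x - t ∈ A}, mem_nhdsWithin_of_mem_nhds ?_, hx0 hx⟩
  filter_upwards [(isOpen_interior.preimage (by fun_prop : Continuous fun t => x - t)).mem_nhds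
    hx.2] with t ht using interior_subset ht

/-- A lower bound for `μ (x - A)` valid for almost every `x ∈ A` holds everywhere on `A`,
by upper semicontinuity. -/
lemma le_measure_sub_mem_of_ae {ν μ : Measure X} [ν.IsOpenPosMeasure] [IsLocallyFiniteMeasure μ]
    {A : Set X} (hc : IsCompact A) (hA : Convex ℝ A) (hint : (interior A).Nonempty) {c : ℝ≥0∞}
    (h : ∀ᵐ x ∂ν.restrict A, c ≤ μ {t | x - t ∈ A}) {x : X} (hx : x ∈ A) :
    c ≤ μ {t | x - t ∈ A} := by
  by_contra! hlt
  obtain ⟨U, hU, hUo, hUc⟩ := Set.exists_isOpen_lt_of_lt _ _ hlt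
  have hev : ∀ᶠ y in nhds x, ∀ a ∈ A, y - a ∈ U := by
    refine hc.eventually_forall_of_forall_eventually fun a ha => ?_
    exact (hUo.preimage (by fun_prop : Continuous fun q : X × X => q.1 - q.2)).mem_nhds
      (hU (by simpa using ha))
  obtain ⟨W, hWU, hWo, hxW⟩ := eventually_nhds_iff.1 hev
  have hxcl : x ∈ closure (interior A) := by
    rw [hA.closure_interior_eq_closure_of_nonempty_interior hint]
    exact subset_closure hx
  have hpos : ν (W ∩ interior A) ≠ 0 :=
    (hWo.inter isOpen_interior).measure_ne_zero ν (mem_closure_iff.1 hxcl W hWo hxW)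
  have h' := ae_restrict_of_ae_restrict_of_subset (s := W ∩ interior A)
    (fun y hy => interior_subset hy.2) h
  rw [ae_restrict_iff' (hWo.inter isOpen_interior).measurableSet] at h'
  obtain ⟨y, hy, hyc⟩ := (frequently_ae_mem_iff.2 hpos).and_eventually h' |>.exists
  refine absurd (hyc hy) (not_le.2 (lt_of_le_of_lt (measure_mono fun t ht => ?_) hUc))
  simpa using hWU y hy.1 _ ht

/-- If `μ (y - F) ≥ 1` for all `y ∈ S`, then `σ S ≤ ∫ σ (S ∩ (F + t)) dμ(t)`, by Tonelli. -/
lemma measure_le_lintegral_measure_sub_mem {σ μ : Measure X} [SFinite μ] {S F : Set X}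
    (hS : MeasurableSet S) (hF : MeasurableSet F) (hfin : σ S ≠ ∞)
    (h : ∀ y ∈ S, 1 ≤ μ {t | y - t ∈ F}) :
    σ S ≤ ∫⁻ t, σ (S ∩ {y | y - t ∈ F}) ∂μ := by
  have : IsFiniteMeasure (σ.restrict S) := isFiniteMeasure_restrict.2 hfin
  have hG : MeasurableSet {q : X × X | q.1 - q.2 ∈ F} := hF.preimage (by fun_prop)
  calc σ S = ∫⁻ _ in S, 1 ∂σ := by simp
    _ ≤ ∫⁻ y in S, μ (Prod.mk y ⁻¹' {q : X × X | q.1 - q.2 ∈ F}) ∂σ :=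
      setLIntegral_mono' hS h
    _ = ((σ.restrict S).prod μ) {q : X × X | q.1 - q.2 ∈ F} := (Measure.prod_apply hG).symm
    _ = ∫⁻ t, σ.restrict S {y | y - t ∈ F} ∂μ := Measure.prod_apply_symm hG
    _ = _ := by
      refine lintegral_congr fun t => ?_
      rw [inter_comm]
      exact Measure.restrict_apply (hF.preimage (by fun_prop : Measurable fun y : X => y - t))

end Measure

section Hausdorff

variable {X : Type*} [NormedAddCommGroup X] [InnerProductSpace ℝ X]

/-- A codimension-one set lying in a level set of `⟪·, ξ⟫` spans the whole hyperplane `ξᗮ`. -/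
lemma direction_affineSpan_eq_orthogonal [FiniteDimensional ℝ X] {F : Set X} {ξ : X} (hξ : ξ ≠ 0)
    (hF : ∀ y ∈ F, ∀ z ∈ F, ⟪y, ξ⟫ = ⟪z, ξ⟫)
    (hdim : Module.finrank ℝ (affineSpan ℝ F).direction + 1 = Module.finrank ℝ X) :
    (affineSpan ℝ F).direction = (ℝ ∙ ξ)ᗮ := by
  refine Submodule.eq_of_le_of_finrank_eq ?_ ?_
  · rw [direction_affineSpan, vectorSpan_def, Submodule.span_le]
    rintro _ ⟨y, hy, z, hz, rfl⟩
    rw [SetLike.mem_coe, Submodule.mem_orthogonal_singleton_iff_inner_left]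
    simp [inner_sub_left, hF y hy z hz]
  · have h := Submodule.finrank_add_finrank_orthogonal (ℝ ∙ ξ)
    rw [finrank_span_singleton hξ] at h
    omega

/-- The isometric inclusion of the direction of a subspace as an affine subspace through `p`. -/
lemma isometry_coe_add (V : Submodule ℝ X) (p : X) : Isometry fun v : V => (v : X) + p :=
  Isometry.of_dist_eq fun v w => by simp [Subtype.dist_eq]

lemma image_preimage_coe_add {F : Set X} {p : X} (hp : p ∈ F) :
    (fun v : (affineSpan ℝ F).direction => (v : X) + p) ''
      ((fun v : (affineSpan ℝ F).direction => (v : X) + p) ⁻¹' F) = F := by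
  rw [image_preimage_eq_iff]
  intro y hy
  exact ⟨⟨y - p, AffineSubspace.vsub_mem_direction (subset_affineSpan ℝ F hy)
    (subset_affineSpan ℝ F hp)⟩, by simp⟩

lemma coe_add_sub_mem_intrinsicInterior {F : Set X} {V : Submodule ℝ X} {p : X} {v w : V}
    (hF : (fun v : V => (v : X) + p) '' ((fun v : V => (v : X) + p) ⁻¹' F) = F)
    (hv : v ∈ interior ((fun v : V => (v : X) + p) ⁻¹' F)) (hw : (w : X) + p ∈ F) :
    ((v : X) + p) - (w + p) ∈ intrinsicInterior ℝ (F - F) := by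
  set K : Set V := (fun v : V => (v : X) + p) ⁻¹' F
  have himage : V.subtypeₗᵢ.toAffineIsometry '' (K - K) = F - F := by
    conv_rhs => rw [← hF]
    ext y
    simp only [mem_image, Set.mem_sub]
    constructor
    · rintro ⟨_, ⟨a, ha, b, hb, rfl⟩, rfl⟩
      exact ⟨_, ⟨a, ha, rfl⟩, _, ⟨b, hb, rfl⟩, by simp⟩
    · rintro ⟨_, ⟨a, ha, rfl⟩, _, ⟨b, hb, rfl⟩, rfl⟩
      exact ⟨_, ⟨a, ha, b, hb, rfl⟩, by simp⟩
  rw [← himage, AffineIsometry.intrinsicInterior_image]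
  refine ⟨v - w, interior_subset_intrinsicInterior ?_, by simp⟩
  exact subset_interior_sub_left (sub_mem_sub hv hw)

/-- Around a relative interior point, the facet contains a neighbourhood within its hyperplane. -/
lemma eventually_mem_of_mem_interior_preimage {F : Set X} {ξ p : X} {V : Submodule ℝ X}
    (hV : V = (ℝ ∙ ξ)ᗮ) {v : V} (hv : v ∈ interior ((fun v : V => (v : X) + p) ⁻¹' F)) :
    ∀ᶠ y in nhds ((v : X) + p), ⟪y, ξ⟫ = ⟪(v : X) + p, ξ⟫ → y ∈ F := by
  obtain ⟨ε, hε, hball⟩ := Metric.mem_nhds_iff.1 (mem_interior_iff_mem_nhds.1 hv)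
  filter_upwards [Metric.ball_mem_nhds _ hε] with y hy hyξ
  have hmem : y - p ∈ V := by
    have h2 : y - ((v : X) + p) ∈ V := by
      refine hV.ge (Submodule.mem_orthogonal_singleton_iff_inner_left.2 ?_)
      rw [inner_sub_left, hyξ, sub_self]
    convert V.add_mem h2 v.2 using 1
    abel
  have h : (⟨y - p, hmem⟩ : V) ∈ Metric.ball v ε := by
    rw [Metric.mem_ball, Subtype.dist_eq]
    rw [Metric.mem_ball] at hy
    convert hy using 1
    simp [dist_eq_norm, sub_sub, add_comm]
  simpa using hball h

variable [FiniteDimensional ℝ X] [MeasurableSpace X] [BorelSpace X]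

lemma hausdorffMeasure_lt_top_of_isCompact {F : Set X} {V : Submodule ℝ X} {p : X} {e : ℝ}
    (he : e = Module.finrank ℝ V)
    (hF : (fun v : V => (v : X) + p) '' ((fun v : V => (v : X) + p) ⁻¹' F) = F)
    (hc : IsCompact F) : μH[e] F < ∞ := by
  rw [← hF, (isometry_coe_add V p).hausdorffMeasure_image (Or.inl (by rw [he]; positivity)), he]
  exact ((isometry_coe_add V p).isClosedEmbedding.isCompact_preimage hc).measure_lt_top

/-- The relative boundary of a compact convex set is a Hausdorff null set. -/
lemma hausdorffMeasure_diff_image_interior {F : Set X} {V : Submodule ℝ X} {p : X} {e : ℝ}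
    (he : e = Module.finrank ℝ V)
    (hF : (fun v : V => (v : X) + p) '' ((fun v : V => (v : X) + p) ⁻¹' F) = F)
    (hconv : Convex ℝ F) :
    μH[e] (F \ (fun v : V => (v : X) + p) '' interior ((fun v : V => (v : X) + p) ⁻¹' F)) = 0 := by
  set K : Set V := (fun v : V => (v : X) + p) ⁻¹' F
  have hKconv : Convex ℝ K := by
    have : K = V.subtype ⁻¹' ((fun z => z + p) ⁻¹' F) := rfl
    rw [this]
    exact (hconv.translate_preimage_left p).linear_preimage _
  have hsub : F \ (fun v : V => (v : X) + p) '' interior K ⊆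
      (fun v : V => (v : X) + p) '' frontier K := by
    conv_lhs => rw [← hF]
    rintro _ ⟨⟨v, hv, rfl⟩, hv'⟩
    exact ⟨v, ⟨subset_closure hv, fun h => hv' ⟨v, h, rfl⟩⟩, rfl⟩
  refine measure_mono_null hsub ?_
  rw [(isometry_coe_add V p).hausdorffMeasure_image (Or.inl (by rw [he]; positivity)), he]
  exact hKconv.addHaar_frontier _

end Hausdorff

/-- If two convex sets with disjoint interiors share a facet that contains a hyperplane
neighbourhood of `x`, they lie on opposite sides of it, and a translate of `A` by `x - a` with
`a ∈ A` not on the hyperplane overlaps `B`. -/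
lemma le_inner_of_sub_notMem {X : Type*} [NormedAddCommGroup X] [InnerProductSpace ℝ X]
    {A B : Set X} (hA : Convex ℝ A) (hB : Convex ℝ B)
    (hAint : (interior A).Nonempty) (hBint : (interior B).Nonempty)
    (hdisj : interior A ∩ interior B = ∅) {ξ x a : X} {κ : ℝ} (hξ : ξ ≠ 0) (hκ : κ ≠ 0)
    (hmaxA : ∀ z ∈ A, ⟪z, ξ⟫ ≤ ⟪x, ξ⟫) (hmaxB : ∀ z ∈ B, ⟪z, κ • ξ⟫ ≤ ⟪x, κ • ξ⟫)
    (hx : ∀ᶠ y in nhds x, ⟪y, ξ⟫ = ⟪x, ξ⟫ → y ∈ A ∩ B)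
    (ha : a ∈ A) (hxa : x - a ∉ interior B - interior A) : ⟪x, ξ⟫ ≤ ⟪a, ξ⟫ := by
  by_contra! hlt
  obtain ⟨a₀, ha₀⟩ := hAint
  obtain ⟨b₀, hb₀⟩ := hBint
  have hxA := hA.eventually_mem_interior_of_inner_lt ha₀ (inner_lt_of_mem_interior hξ hmaxA ha₀)
    (hx.mono fun y hy h => (hy h).1)
  have hxB := hB.eventually_mem_interior_of_inner_lt hb₀
    (inner_lt_of_mem_interior (smul_ne_zero hκ hξ) hmaxB hb₀)
    (hx.mono fun y hy h => (hy (by simpa [real_inner_smul_right, hκ] using h)).2)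
  simp only [real_inner_smul_right] at hxB
  rcases hκ.lt_or_gt with hneg | hpos
  · refine hxa (sub_mem_interior_sub_interior hA hξ hxA (hxB.mono fun z hz h => hz ?_) ha hlt)
    exact mul_lt_mul_of_neg_left h hneg
  · have hcont : Tendsto (fun s : ℝ => x - s • ξ) (nhdsWithin 0 (Ioi 0)) (nhds x) := by
      have : Continuous (fun s : ℝ => x - s • ξ) := by fun_prop
      simpa using (this.tendsto 0).mono_left nhdsWithin_le_nhds
    obtain ⟨s, ⟨h1, h2⟩, hs⟩ :=
      ((hcont.eventually (hxA.and hxB)).and self_mem_nhdsWithin).exists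
    have hs' : ⟪x - s • ξ, ξ⟫ < ⟪x, ξ⟫ := by
      rw [inner_sub_left, real_inner_smul_left]
      have : 0 < s * ⟪ξ, ξ⟫ := mul_pos hs (real_inner_self_pos.2 hξ)
      linarith
    exact (Set.eq_empty_iff_forall_notMem.1 hdisj) _
      ⟨h1 hs', h2 (mul_lt_mul_of_pos_left hs' hpos)⟩

/-- Let `A, B` be convex polytopes with nonempty disjoint interiors sharing a common facet `F`,
and `μ` a positive locally finite measure with `1_A ∗ μ ≥ 1` a.e. on `A` and `1_A ∗ μ = 0`
a.e. on `B`. If `μ'` is the restriction of `μ` to `relint(F - F)` and `σ_F` is the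
`(d-1)`-dimensional Hausdorff measure restricted to `F`, then
`(σ_F ∗ μ')(E) = ∫∫ 1_E(y + t) dσ_F(y) dμ'(t) ≥ σ_F(E)` for every Borel set `E`. -/
theorem facet_weak_tiling
    (d : ℕ) (A B F : Set (EuclideanSpace ℝ (Fin d)))
    (hA : IsConvexPolytope A) (hB : IsConvexPolytope B)
    (hAint : (interior A).Nonempty) (hBint : (interior B).Nonempty)
    (hdisj : interior A ∩ interior B = ∅)
    (hFA : IsFacetOf A F) (hFB : IsFacetOf B F)
    (μ : Measure (EuclideanSpace ℝ (Fin d))) (hμ : IsLocallyFiniteMeasure μ)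
    (hge : ∀ᵐ x ∂((volume : Measure (EuclideanSpace ℝ (Fin d))).restrict A),
      1 ≤ ∫⁻ t, Set.indicator A (fun _ => (1 : ℝ≥0∞)) (x - t) ∂μ)
    (hzero : ∀ᵐ x ∂((volume : Measure (EuclideanSpace ℝ (Fin d))).restrict B),
      (∫⁻ t, Set.indicator A (fun _ => (1 : ℝ≥0∞)) (x - t) ∂μ) = 0) :
    ∀ E : Set (EuclideanSpace ℝ (Fin d)), MeasurableSet E →
      ((μH[((d : ℝ) - 1)] : Measure (EuclideanSpace ℝ (Fin d))).restrict F) E ≤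
        ∫⁻ t, ∫⁻ y, Set.indicator E (fun _ => (1 : ℝ≥0∞)) (y + t)
            ∂((μH[((d : ℝ) - 1)] : Measure (EuclideanSpace ℝ (Fin d))).restrict F)
          ∂(μ.restrict (intrinsicInterior ℝ (F - F))) := by
  obtain ⟨⟨ξ, hξ, hFξ⟩, hdim⟩ := hFA
  obtain ⟨⟨η, hη, hFη⟩, -⟩ := hFB
  obtain ⟨SA, hSA, rfl⟩ := hA
  obtain ⟨SB, hSB, rfl⟩ := hB
  set A := convexHull ℝ SA
  set B := convexHull ℝ SB
  have hAconv : Convex ℝ A := convex_convexHull ℝ SA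
  have hBconv : Convex ℝ B := convex_convexHull ℝ SB
  have hAcomp : IsCompact A := hSA.isCompact_convexHull ℝ
  have hFA : F ⊆ A := hFξ ▸ sep_subset _ _
  have hFB : F ⊆ B := hFη ▸ sep_subset _ _
  have hmaxA : ∀ y ∈ F, ∀ z ∈ A, ⟪z, ξ⟫ ≤ ⟪y, ξ⟫ := fun y hy => (hFξ ▸ hy).2
  have hmaxB : ∀ y ∈ F, ∀ z ∈ B, ⟪z, η⟫ ≤ ⟪y, η⟫ := fun y hy => (hFη ▸ hy).2
  obtain ⟨p, hp⟩ : F.Nonempty := by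
    obtain ⟨p, hpA, hp⟩ := hAcomp.exists_isMaxOn (hAint.mono interior_subset)
      (by fun_prop : Continuous fun z => ⟪z, ξ⟫).continuousOn
    exact ⟨p, hFξ ▸ ⟨hpA, hp⟩⟩
  have hmem : ∀ a ∈ A, ⟪p, ξ⟫ ≤ ⟪a, ξ⟫ → a ∈ F := fun a ha h => by
    rw [hFξ]
    exact ⟨ha, fun z hz => (hmaxA p hp z hz).trans h⟩
  have hF_eq : F = A ∩ {a | ⟪p, ξ⟫ ≤ ⟪a, ξ⟫} :=
    Subset.antisymm (fun a ha => ⟨hFA ha, hmaxA a ha p (hFA hp)⟩) fun a ha => hmem a ha.1 ha.2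
  have hFcomp : IsCompact F := by
    rw [hF_eq]
    exact hAcomp.inter_right (isClosed_le continuous_const (by fun_prop))
  have hFconv : Convex ℝ F := by
    rw [hF_eq]
    refine hAconv.inter (convex_halfSpace_ge ⟨fun x y => ?_, fun c x => ?_⟩ _)
    · exact inner_add_left x y ξ
    · exact real_inner_smul_left x ξ c
  have hd : d - 1 + 1 = d := by
    rcases d with - | d
    · exact absurd (Subsingleton.elim ξ 0) hξ
    · rfl
  have hdim' : Module.finrank ℝ (affineSpan ℝ F).direction + 1 =
      Module.finrank ℝ (EuclideanSpace ℝ (Fin d)) := by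
    rw [hdim, hd, finrank_euclideanSpace_fin]
  have he : (d : ℝ) - 1 = Module.finrank ℝ (affineSpan ℝ F).direction := by
    rw [hdim, sub_eq_iff_eq_add]
    exact_mod_cast hd.symm
  have hVξ := direction_affineSpan_eq_orthogonal hξ (fun y hy z hz =>
    (hmaxA z hz y (hFA hy)).antisymm (hmaxA y hy z (hFA hz))) hdim'
  have hVη := direction_affineSpan_eq_orthogonal hη (fun y hy z hz =>
    (hmaxB z hz y (hFB hy)).antisymm (hmaxB y hy z (hFB hz))) hdim'
  obtain ⟨κ, rfl⟩ : ∃ κ : ℝ, κ • ξ = η := by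
    rw [← Submodule.mem_span_singleton, ← Submodule.orthogonal_orthogonal (ℝ ∙ ξ), ← hVξ, hVη,
      Submodule.orthogonal_orthogonal]
    exact Submodule.mem_span_singleton_self η
  have hκ : κ ≠ 0 := (smul_ne_zero_iff.1 hη).1
  have himage := image_preimage_coe_add hp
  set V := (affineSpan ℝ F).direction
  set j : V → EuclideanSpace ℝ (Fin d) := fun v => (v : EuclideanSpace ℝ (Fin d)) + p
  set R : Set (EuclideanSpace ℝ (Fin d)) := j '' interior (j ⁻¹' F)
  have hRF : R ⊆ F := image_subset_iff.2 interior_subset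
  have hRmeas : MeasurableSet R :=
    (isometry_coe_add V p).isClosedEmbedding.measurableEmbedding.measurableSet_image.2
      isOpen_interior.measurableSet
  have hconv_eq : ∀ x, ∫⁻ t, Set.indicator A (fun _ => (1 : ℝ≥0∞)) (x - t) ∂μ =
      μ {t | x - t ∈ A} := fun x =>
    lintegral_indicator_one (hAcomp.measurableSet.preimage (measurable_const.sub measurable_id))
  simp only [hconv_eq] at hge hzero
  have hnull := measure_interior_sub_interior_eq_zero_s19 hzero
  have hcover : ∀ x ∈ R, 1 ≤ μ.restrict (intrinsicInterior ℝ (F - F)) {t | x - t ∈ F} := by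
    intro x hx
    refine (le_measure_sub_mem_of_ae hAcomp hAconv hAint hge (hFA (hRF hx))).trans ?_
    have hsub : {t | x - t ∈ A} ⊆ {t | x - t ∈ F} ∩ intrinsicInterior ℝ (F - F) ∪
        (interior B - interior A) := by
      intro t ht
      by_cases htN : t ∈ interior B - interior A
      · exact Or.inr htN
      left
      have htF : x - t ∈ F := by
        obtain ⟨v, hv, rfl⟩ := hx
        refine hmem _ ht ((hmaxA _ (hRF ⟨v, hv, rfl⟩) p (hFA hp)).trans ?_)
        exact le_inner_of_sub_notMem hAconv hBconv hAint hBint hdisj hξ hκ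
          (hmaxA _ (hRF ⟨v, hv, rfl⟩)) (hmaxB _ (hRF ⟨v, hv, rfl⟩))
          ((eventually_mem_of_mem_interior_preimage hVξ hv).mono
            fun y hy h => ⟨hFA (hy h), hFB (hy h)⟩) ht (by simpa using htN)
      refine ⟨htF, ?_⟩
      obtain ⟨v, hv, rfl⟩ := hx
      obtain ⟨w, hw, hwt⟩ := himage.symm.subset htF
      have := coe_add_sub_mem_intrinsicInterior himage hv hw
      have ht_eq : t = j v - j w := by rw [hwt, sub_sub_cancel]
      rwa [ht_eq]
    calc μ {t | x - t ∈ A} ≤ μ ({t | x - t ∈ F} ∩ intrinsicInterior ℝ (F - F)) +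
          μ (interior B - interior A) := (measure_mono hsub).trans (measure_union_le _ _)
      _ = μ ({t | x - t ∈ F} ∩ intrinsicInterior ℝ (F - F)) := by rw [hnull, add_zero]
      _ ≤ _ := Measure.le_restrict_apply _ _
  intro E hE
  have hfin := hausdorffMeasure_lt_top_of_isCompact he himage hFcomp
  calc (μH[(d : ℝ) - 1]).restrict F E = μH[(d : ℝ) - 1] (E ∩ F) := Measure.restrict_apply hE
    _ ≤ μH[(d : ℝ) - 1] (E ∩ R) + μH[(d : ℝ) - 1] (F \ R) := by
      refine (measure_mono fun y hy => ?_).trans (measure_union_le _ _)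
      by_cases hyR : y ∈ R
      exacts [Or.inl ⟨hy.1, hyR⟩, Or.inr ⟨hy.2, hyR⟩]
    _ = μH[(d : ℝ) - 1] (E ∩ R) := by
      rw [hausdorffMeasure_diff_image_interior he himage hFconv, add_zero]
    _ ≤ ∫⁻ t, μH[(d : ℝ) - 1] (E ∩ R ∩ {y | y - t ∈ F})
          ∂μ.restrict (intrinsicInterior ℝ (F - F)) :=
      measure_le_lintegral_measure_sub_mem (hE.inter hRmeas) hFcomp.measurableSet
        (ne_top_of_le_ne_top hfin.ne (measure_mono (inter_subset_right.trans hRF)))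
        fun y hy => hcover y hy.2
    _ ≤ _ := by
      refine lintegral_mono fun t => ?_
      have hEt : MeasurableSet {y | y + t ∈ E} := hE.preimage (measurable_id.add_const t)
      have hind : ∫⁻ y, Set.indicator E (fun _ => (1 : ℝ≥0∞)) (y + t)
          ∂(μH[(d : ℝ) - 1]).restrict F = (μH[(d : ℝ) - 1]).restrict F {y | y + t ∈ E} :=
        lintegral_indicator_one hEt
      rw [hind, Measure.restrict_apply hEt,
        ← (isometry_add_right t).hausdorffMeasure_image (Or.inr (add_right_surjective t))
          ({y | y + t ∈ E} ∩ F)]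
      refine measure_mono fun y hy => ⟨y - t, ⟨?_, hy.2⟩, sub_add_cancel y t⟩
      simpa using hy.1.1
end
end
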